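/- arXiv:2012.15011 — 2 statements merged into one kernel-verified Lean document; each statement's English description precedes it below -/
import Mathlib

section
/- Let λ = (λ_1 ≥ … ≥ λ_ℓ > 0) be a partition with exactly ℓ positive parts, ℓ ≤ n, and suppose λ_1 = λ_2 = … = λ_k for some 1 ≤ k ≤ ℓ. Set x_{n+j} := t_j for j = 1,…,k−1. Then, as an identity in the field of rational functions in x_1,…,x_n, t_1,…,t_{ℓ−1}: g_λ(x_1,…,x_n; t_1,…,t_{ℓ−1}) = Σ_{S} [ ∏_{i ∈ S̄} ∏_{j ∈ S} x_j/(x_j − x_i) ] · g_λ(x_{j_1},…,x_{j_{ℓ−k+1}}; x_{j_{ℓ−k+2}},…,x_{j_ℓ}, t_k,…,t_{ℓ−1}), where the sum is over all ℓ-element subsets S = {j_1 < j_2 < … < j_ℓ} of {1,2,…,n+k−1}, and S̄ = {1,…,n+k−1} \ S. (On the right, g_λ is evaluated with x-alphabet of size ℓ−k+1 and parameter list (x_{j_{ℓ−k+2}},…,x_{j_ℓ}, t_k,…,t_{ℓ−1}) of length ℓ−1.) -/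
open scoped Classical

noncomputable section

variable {R : Type*} [CommRing R]

/-- The boxes of the Young diagram with row lengths `lam 0, …, lam (ℓ-1)`
(a box in row `r < ℓ` and column `c < lam r`, both 0-indexed). -/
abbrev YBox (ℓ : ℕ) (lam : ℕ → ℕ) : Type := Σ r : Fin ℓ, Fin (lam r.1)

/-- A reverse plane partition of skew shape `lam/mu` with entries in `{1, …, n}`,
encoded as a filling of the boxes of `lam` by values in `Fin (n+1)`, where the
value `0` is used exactly on the boxes of `mu`; rows weakly increase and
columns weakly increase. -/
def IsSkewRPP (ℓ n : ℕ) (lam mu : ℕ → ℕ) (T : YBox ℓ lam → Fin (n + 1)) : Prop :=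
  (∀ b : YBox ℓ lam, ((T b : ℕ) = 0 ↔ (b.2 : ℕ) < mu b.1.1)) ∧
  (∀ (r : Fin ℓ) (c c' : Fin (lam r.1)), mu r.1 ≤ (c : ℕ) → (c : ℕ) ≤ (c' : ℕ) →
    T ⟨r, c⟩ ≤ T ⟨r, c'⟩) ∧
  (∀ (r r' : Fin ℓ) (c : Fin (lam r.1)) (c' : Fin (lam r'.1)),
    (r : ℕ) ≤ (r' : ℕ) → (c : ℕ) = (c' : ℕ) → mu r.1 ≤ (c : ℕ) → mu r'.1 ≤ (c' : ℕ) →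
    T ⟨r, c⟩ ≤ T ⟨r', c'⟩)

/-- The weight of a box `b` of the skew shape `lam/mu` in a reverse plane
partition `T`: it is `t (r+1)` (`r+1` being the 1-indexed row of `b`) if the box
directly below `b` exists (in `lam`) and carries the same entry, and `x e`
otherwise, where `e ∈ {1, …, n}` is the entry of `b`.  Boxes of `mu` have
weight `1`. -/
def boxWeight (ℓ n : ℕ) (lam mu : ℕ → ℕ) (x t : ℕ → R)
    (T : YBox ℓ lam → Fin (n + 1)) (b : YBox ℓ lam) : R :=
  if mu b.1.1 ≤ (b.2 : ℕ) then
    if ∃ (hr : (b.1 : ℕ) + 1 < ℓ) (hc : (b.2 : ℕ) < lam ((b.1 : ℕ) + 1)),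
        T ⟨⟨(b.1 : ℕ) + 1, hr⟩, ⟨(b.2 : ℕ), hc⟩⟩ = T b
      then t ((b.1 : ℕ) + 1)
      else x (T b : ℕ)
  else 1

/-- The (skew) refined dual Grothendieck polynomial `g_{lam/mu}(x; t)`:
the sum of `∏_r t_r^{b_r(T)} ∏_i x_i^{a_i(T)}` over all reverse plane
partitions `T` of shape `lam/mu` with entries in `{1, …, n}`, where `b_r(T)`
is the number of boxes in row `r` whose entry equals that of the box directly
below it, and `a_i(T)` is the number of columns containing the entry `i`. -/
def dualGroth (ℓ n : ℕ) (lam mu : ℕ → ℕ) (x t : ℕ → R) : R :=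
  ∑ T ∈ Finset.univ.filter (IsSkewRPP ℓ n lam mu),
    ∏ b : YBox ℓ lam, boxWeight ℓ n lam mu x t T b

/-- Complete homogeneous symmetric function `h_k` of the entries of a list. -/
def hL (k : ℕ) (L : List R) : R :=
  ∑ f ∈ Finset.univ.filter (fun f : Fin k → Fin L.length => Monotone f),
    ∏ i, L.get (f i)

/-- Elementary symmetric function `e_k` of the entries of a list. -/
def eL (k : ℕ) (L : List R) : R :=
  ∑ f ∈ Finset.univ.filter (fun f : Fin k → Fin L.length => StrictMono f),
    ∏ i, L.get (f i)

/-- `h_d` for an integer degree `d`, with `h_d = 0` for `d < 0`. -/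
def hInt (d : ℤ) (L : List R) : R := if 0 ≤ d then hL d.toNat L else 0

/-- `e_d` for an integer degree `d`, with `e_d = 0` for `d < 0`. -/
def eInt (d : ℤ) (L : List R) : R := if 0 ≤ d then eL d.toNat L else 0

/-- Extend a function on `Fin ℓ` to `ℕ` by `0`. -/
def extendFin (ℓ : ℕ) (p : Fin ℓ → ℕ) : ℕ → ℕ :=
  fun r => if h : r < ℓ then p ⟨r, h⟩ else 0

/-- A semistandard Young tableau of shape `lam` with entries in `{1, …, N}`
(encoded with values in `Fin (N+1)`, the value `0` being unused): rows weakly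
increase and columns strictly increase. -/
def IsSSYT (ℓ N : ℕ) (lam : ℕ → ℕ) (T : YBox ℓ lam → Fin (N + 1)) : Prop :=
  (∀ b : YBox ℓ lam, 1 ≤ (T b : ℕ)) ∧
  (∀ (r : Fin ℓ) (c c' : Fin (lam r.1)), (c : ℕ) ≤ (c' : ℕ) → T ⟨r, c⟩ ≤ T ⟨r, c'⟩) ∧
  (∀ (r r' : Fin ℓ) (c : Fin (lam r.1)) (c' : Fin (lam r'.1)),
    (r : ℕ) < (r' : ℕ) → (c : ℕ) = (c' : ℕ) → T ⟨r, c⟩ < T ⟨r', c'⟩)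

/-- The Schur polynomial `s_lam (z 1, …, z N)`: the sum of `z^T` over all
semistandard Young tableaux of shape `lam` with entries in `{1, …, N}`. -/
def schurPoly (ℓ N : ℕ) (lam : ℕ → ℕ) (z : ℕ → R) : R :=
  ∑ T ∈ Finset.univ.filter (IsSSYT ℓ N lam),
    ∏ b : YBox ℓ lam, z (T b : ℕ)


/-- The extended alphabet: `X i = x i` for `1 ≤ i ≤ n` and `X (n+j) = t j`. -/
def extAlphabet {F : Type*} (n : ℕ) (x t : ℕ → F) : ℕ → F :=
  fun i => if i ≤ n then x i else t (i - n)

/-- The geometric series `1 + a z + a² z² + ⋯`. -/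
def geom (a : R) : PowerSeries R := PowerSeries.mk fun m => a ^ m

/-- The coefficient of a power series at an integer index, zero at negative indices. -/
def zcoeff (P : PowerSeries R) (m : ℤ) : R :=
  if 0 ≤ m then PowerSeries.coeff m.toNat P else 0

theorem zcoeff_of_neg (P : PowerSeries R) {m : ℤ} (hm : m < 0) : zcoeff P m = 0 := by
  simp [zcoeff, not_le.mpr hm]

theorem zcoeff_natCast (P : PowerSeries R) (m : ℕ) :
    zcoeff P (m : ℤ) = PowerSeries.coeff m P := by
  simp [zcoeff]

theorem geom_eq (a : R) : geom a = 1 + PowerSeries.C a * (geom a * PowerSeries.X) := by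
  ext m
  cases m with
  | zero => simp [geom]
  | succ m => simp [geom, PowerSeries.coeff_one, pow_succ, mul_comm]

theorem zcoeff_mul_geom (P : PowerSeries R) (a : R) (m : ℤ) :
    zcoeff (P * geom a) m = zcoeff P m + a * zcoeff (P * geom a) (m - 1) := by
  rcases lt_or_ge m 0 with hm | hm
  · rw [zcoeff_of_neg _ hm, zcoeff_of_neg _ hm, zcoeff_of_neg _ (by lia)]; simp
  obtain ⟨k, rfl⟩ := Int.eq_ofNat_of_zero_le hm
  have h : P * geom a = P + PowerSeries.C a * ((P * geom a) * PowerSeries.X) := by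
    conv_lhs => rw [geom_eq]
    ring
  rw [zcoeff_natCast, zcoeff_natCast]
  conv_lhs => rw [h]
  cases k with
  | zero =>
    rw [zcoeff_of_neg _ (by simp)]
    simp
  | succ k =>
    rw [show ((k + 1 : ℕ) : ℤ) - 1 = (k : ℤ) by push_cast; ring, zcoeff_natCast]
    simp [PowerSeries.coeff_succ_mul_X]

/-- Exchange relation between two added variables. -/
theorem zcoeff_exchange (P : PowerSeries R) (a b : R) (m : ℤ) :
    a * zcoeff (P * geom a) m - b * zcoeff (P * geom b) m =
      (a - b) * zcoeff (P * geom a * geom b) m := by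
  have h1 := zcoeff_mul_geom (P * geom a) b m
  have h2 := zcoeff_mul_geom (P * geom b) a m
  rw [mul_right_comm P (geom b) (geom a)] at h2
  linear_combination (-a) * h1 + b * h2

theorem sum_pow_mul_zcoeff (P : PowerSeries R) (a : R) (lo d : ℤ) (hlo : lo + d ≤ 0)
    (v : ℤ) (hv : lo - 1 ≤ v) :
    ∑ u ∈ Finset.Icc lo v, a ^ (v - u).toNat * zcoeff P (u + d) =
      zcoeff (P * geom a) (v + d) := by
  induction v, hv using Int.leInduction with
  | base => rw [Finset.Icc_eq_empty (by lia), zcoeff_of_neg _ (by lia)]; simp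
  | succ v hv ih =>
    have hins : Finset.Icc lo (v + 1) = insert (v + 1) (Finset.Icc lo v) := by
      ext u; simp only [Finset.mem_insert, Finset.mem_Icc]; lia
    rw [hins, Finset.sum_insert (by simp), zcoeff_mul_geom,
      show v + 1 + d - 1 = v + d by ring, ← ih, Finset.mul_sum]
    congr 1
    · simp
    · refine Finset.sum_congr rfl fun u hu => ?_
      rw [Finset.mem_Icc] at hu
      rw [show (v + 1 - u).toNat = (v - u).toNat + 1 by lia, pow_succ]
      ring

/-- The weight of the boxes strictly to the right of column `u` in a row of length `p`
lying above a row of length `q`. -/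
def rowWeight (x t : R) (p q u : ℤ) : R := x ^ (p - max u q).toNat * t ^ (q - u).toNat

theorem sum_rowWeight_below (P : PowerSeries R) (x t : R) (p q lo d v : ℤ)
    (hlo : lo + d ≤ 0) (hv : lo ≤ v) (hvq : v ≤ q) :
    ∑ u ∈ Finset.Icc lo (v - 1), rowWeight x t p q u * zcoeff P (u + d) =
      x ^ (p - q).toNat * t ^ (q - v + 1).toNat * zcoeff (P * geom t) (v - 1 + d) := by
  rw [← sum_pow_mul_zcoeff P t lo d hlo (v - 1) (by lia), Finset.mul_sum]
  refine Finset.sum_congr rfl fun u hu => ?_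
  rw [Finset.mem_Icc] at hu
  rw [rowWeight, max_eq_right (by lia),
    show (q - u).toNat = (q - v + 1).toNat + (v - 1 - u).toNat by lia, pow_add]
  ring

theorem sum_rowWeight (P : PowerSeries R) (x t : R) (p q lo d : ℤ)
    (hlo : lo + d ≤ 0) (hq : lo ≤ q) (hpq : q ≤ p) :
    ∑ u ∈ Finset.Icc lo p, rowWeight x t p q u * zcoeff P (u + d) =
      zcoeff (P * geom x) (p + d) +
        x ^ (p - q).toNat * (t - x) * zcoeff (P * geom t * geom x) (q - 1 + d) := by
  have hsplit : Finset.Icc lo p = Finset.Icc lo (q - 1) ∪ Finset.Icc q p := by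
    ext u; simp only [Finset.mem_union, Finset.mem_Icc]; lia
  have hdisj : Disjoint (Finset.Icc lo (q - 1)) (Finset.Icc q p) := by
    rw [Finset.disjoint_left]; intro u; simp only [Finset.mem_Icc]; lia
  have h1 := sum_rowWeight_below P x t p q lo d q hlo hq le_rfl
  have h2 := sum_pow_mul_zcoeff P x lo d hlo p (by lia)
  have h3 := sum_pow_mul_zcoeff P x lo d hlo (q - 1) (by lia)
  rw [hsplit, Finset.sum_union hdisj] at h2 ⊢
  have h4 : ∑ u ∈ Finset.Icc lo (q - 1), x ^ (p - u).toNat * zcoeff P (u + d) =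
      x ^ (p - q).toNat * x * ∑ u ∈ Finset.Icc lo (q - 1),
        x ^ (q - 1 - u).toNat * zcoeff P (u + d) := by
    rw [Finset.mul_sum]
    refine Finset.sum_congr rfl fun u hu => ?_
    rw [Finset.mem_Icc] at hu
    rw [show (p - u).toNat = (p - q).toNat + 1 + (q - 1 - u).toNat by lia, pow_add, pow_add]
    ring
  have h5 : ∑ u ∈ Finset.Icc q p, rowWeight x t p q u * zcoeff P (u + d) =
      ∑ u ∈ Finset.Icc q p, x ^ (p - u).toNat * zcoeff P (u + d) := by
    refine Finset.sum_congr rfl fun u hu => ?_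
    rw [Finset.mem_Icc] at hu
    rw [rowWeight, max_eq_left (by lia), show (q - u).toNat = 0 by lia]
    simp
  rw [h4, h3] at h2
  rw [h5, h1, show (q - q + 1).toNat = 1 by simp, pow_one]
  linear_combination h2 + x ^ (p - q).toNat * zcoeff_exchange P t x (q - 1 + d)

/-- A sum of determinants over weakly decreasing choices of rows equals the corresponding sum
over all choices, provided that in each row the partial sums are proportional to the next row. -/
theorem sum_antitone_det_eq {ℓ : ℕ} (lo : ℤ) (hi : Fin ℓ → ℤ)
    (w : Fin ℓ → ℤ → R) (row : Fin ℓ → ℤ → Fin ℓ → R)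
    (hhi : ∀ (i : Fin ℓ) (h : (i : ℕ) + 1 < ℓ), hi ⟨i + 1, h⟩ ≤ hi i)
    (hrow : ∀ (i : Fin ℓ) (h : (i : ℕ) + 1 < ℓ) (v : ℤ), lo ≤ v → v ≤ hi ⟨i + 1, h⟩ →
      ∃ c : R, ∑ u ∈ Finset.Icc lo (v - 1), w i u • row i u = c • row ⟨i + 1, h⟩ v) :
    ∑ q ∈ (Fintype.piFinset fun i => Finset.Icc lo (hi i)).filter
        (fun q => ∀ (i : Fin ℓ) (h : (i : ℕ) + 1 < ℓ), q ⟨i + 1, h⟩ ≤ q i),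
      (∏ i, w i (q i)) * (Matrix.of fun i => row i (q i)).det =
    (Matrix.of fun i => ∑ u ∈ Finset.Icc lo (hi i), w i u • row i u).det := by
  set f : (Fin ℓ → ℤ) → R := fun q => (∏ i, w i (q i)) * (Matrix.of fun i => row i (q i)).det
    with hf
  have hall : (Matrix.of fun i => ∑ u ∈ Finset.Icc lo (hi i), w i u • row i u).det =
      ∑ q ∈ Fintype.piFinset fun i => Finset.Icc lo (hi i), f q := by
    have h := (Matrix.detRowAlternating (R := R) (n := Fin ℓ)).toMultilinearMap.map_sum_finset
      (fun i u => w i u • row i u) (fun i => Finset.Icc lo (hi i))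
    refine Eq.trans h (Finset.sum_congr rfl fun q _ => ?_)
    exact (Matrix.detRowAlternating (R := R) (n := Fin ℓ)).toMultilinearMap.map_smul_univ
      (fun i => w i (q i)) (fun i => row i (q i))
  rw [hall]
  have key : ∀ k : ℕ, ∑ q ∈ (Fintype.piFinset fun i => Finset.Icc lo (hi i)).filter
        (fun q => ∀ (i : Fin ℓ) (h : (i : ℕ) + 1 < ℓ), q ⟨i + 1, h⟩ ≤ q i), f q =
      ∑ q ∈ (Fintype.piFinset fun i => Finset.Icc lo (hi i)).filter
        (fun q => ∀ (i : Fin ℓ) (h : (i : ℕ) + 1 < ℓ), k ≤ i → q ⟨i + 1, h⟩ ≤ q i), f q := by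
    intro k
    induction k with
    | zero => simp
    | succ k ih =>
      rw [ih]
      by_cases hk : k + 1 < ℓ
      swap
      · refine Finset.sum_congr (Finset.filter_congr fun q _ => ?_) fun _ _ => rfl
        exact ⟨fun H i h hi => H i h (by lia), fun H i h hi => H i h (by lia)⟩
      set k0 : Fin ℓ := ⟨k, by lia⟩ with hk0
      set k1 : Fin ℓ := ⟨k + 1, hk⟩ with hk1
      have hne : k1 ≠ k0 := by simp [hk0, hk1]
      rw [← Finset.sum_filter_add_sum_filter_not ((Fintype.piFinset fun i =>
        Finset.Icc lo (hi i)).filter (fun q => ∀ (i : Fin ℓ) (h : (i : ℕ) + 1 < ℓ),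
          k + 1 ≤ i → q ⟨i + 1, h⟩ ≤ q i)) (fun q => q k1 ≤ q k0)]
      have hbad : ∑ q ∈ ((Fintype.piFinset fun i => Finset.Icc lo (hi i)).filter
          (fun q => ∀ (i : Fin ℓ) (h : (i : ℕ) + 1 < ℓ), k + 1 ≤ i → q ⟨i + 1, h⟩ ≤ q i)).filter
          (fun q => ¬ q k1 ≤ q k0), f q = 0 := by
        set B := ((Fintype.piFinset fun i => Finset.Icc lo (hi i)).filter
          (fun q => ∀ (i : Fin ℓ) (h : (i : ℕ) + 1 < ℓ), k + 1 ≤ i → q ⟨i + 1, h⟩ ≤ q i)).filter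
          (fun q => ¬ q k1 ≤ q k0) with hB
        have hmemB : ∀ q, q ∈ B ↔ (∀ i, lo ≤ q i ∧ q i ≤ hi i) ∧
            (∀ (i : Fin ℓ) (h : (i : ℕ) + 1 < ℓ), k + 1 ≤ i → q ⟨i + 1, h⟩ ≤ q i) ∧
            q k0 < q k1 := by
          intro q; simp [hB, Fintype.mem_piFinset, and_assoc]
        rw [← Finset.sum_fiberwise_of_maps_to (g := fun q => Function.update q k0 lo)
          (t := B.image fun q => Function.update q k0 lo)
          (fun q hq => Finset.mem_image_of_mem _ hq)]
        refine Finset.sum_eq_zero fun ν hν => ?_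
        obtain ⟨p, hp, rfl⟩ := Finset.mem_image.mp hν
        have hpB := (hmemB p).mp hp
        have hfib : ∑ q ∈ B.filter (fun q => Function.update q k0 lo = Function.update p k0 lo),
            f q = ∑ u ∈ Finset.Icc lo (p k1 - 1), f (Function.update p k0 u) := by
          refine Finset.sum_bij' (fun q _ => q k0) (fun u _ => Function.update p k0 u) ?_ ?_ ?_ ?_ ?_
          · intro q hq
            obtain ⟨hq, he⟩ := Finset.mem_filter.mp hq
            have hq := (hmemB q).mp hq
            have h1 := congrFun he k1
            simp only [Function.update_of_ne hne] at h1
            rw [Finset.mem_Icc]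
            exact ⟨(hq.1 k0).1, by rw [← h1]; lia⟩
          · intro u hu
            rw [Finset.mem_Icc] at hu
            rw [Finset.mem_filter, hmemB]
            refine ⟨⟨fun i => ?_, fun i h hki => ?_, ?_⟩, by simp⟩
            · by_cases hi0 : i = k0
              · subst hi0
                have h2 := hhi k0 hk
                have h3 := (hpB.1 k1).2
                simp only [Function.update_self]
                refine ⟨hu.1, ?_⟩
                calc u ≤ p k1 := by lia
                  _ ≤ hi k1 := h3
                  _ ≤ _ := h2
              · rw [Function.update_of_ne hi0]; exact hpB.1 i
            · rw [Function.update_of_ne, Function.update_of_ne]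
              · exact hpB.2.1 i h hki
              · intro h; rw [h, hk0] at hki; simp at hki
              · intro h; have := congrArg Fin.val h; rw [hk0] at this; simp at this; lia
            · rw [Function.update_of_ne hne, Function.update_self]; lia
          · intro q hq
            obtain ⟨hq, he⟩ := Finset.mem_filter.mp hq
            have h1 := congrArg (fun g => Function.update g k0 (q k0)) he
            simp only [Function.update_idem, Function.update_eq_self] at h1
            exact h1.symm
          · intro u hu; simp
          · intro q hq
            obtain ⟨hq, he⟩ := Finset.mem_filter.mp hq
            have h1 := congrArg (fun g => Function.update g k0 (q k0)) he
            simp only [Function.update_idem, Function.update_eq_self] at h1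
            rw [← h1]
        rw [hfib]
        have hterm : ∀ u, f (Function.update p k0 u) =
            (∏ i ∈ Finset.univ.erase k0, w i (p i)) *
              Matrix.detRowAlternating (Function.update (fun i => row i (p i)) k0
                (w k0 u • row k0 u)) := by
          intro u
          rw [AlternatingMap.map_update_smul, hf]
          simp only
          rw [← Finset.mul_prod_erase _ _ (Finset.mem_univ k0), Function.update_self]
          have e1 : ∏ i ∈ Finset.univ.erase k0, w i (Function.update p k0 u i) =
              ∏ i ∈ Finset.univ.erase k0, w i (p i) :=
            Finset.prod_congr rfl fun i hi => by
              rw [Function.update_of_ne (Finset.ne_of_mem_erase hi)]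
          have e2 : (fun i => row i (Function.update p k0 u i)) =
              Function.update (fun i => row i (p i)) k0 (row k0 u) := by
            ext i : 1
            by_cases hi0 : i = k0
            · subst hi0; simp
            · simp [Function.update_of_ne hi0]
          rw [e1, e2]
          change _ * Matrix.detRowAlternating _ = _
          rw [smul_eq_mul]
          change _ * Matrix.detRowAlternating (Function.update (fun i => row i (p i)) k0 (row k0 u)) = _
          ring
        simp_rw [hterm]
        rw [← Finset.mul_sum, ← AlternatingMap.map_update_sum]
        obtain ⟨c, hc⟩ := hrow k0 hk (p k1) (hpB.1 k1).1 (hpB.1 k1).2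
        rw [hc, AlternatingMap.map_update_smul]
        have hz : Matrix.detRowAlternating (Function.update (fun i => row i (p i)) k0
            (row k1 (p k1))) = 0 := by
          refine AlternatingMap.map_eq_zero_of_eq _ _ ?_ hne.symm
          rw [Function.update_self, Function.update_of_ne hne]
        change _ * (c • Matrix.detRowAlternating (Function.update (fun i => row i (p i)) k0
            (row k1 (p k1)))) = 0
        rw [hz]; simp
      rw [hbad, add_zero, Finset.filter_filter]
      refine Finset.sum_congr (Finset.filter_congr fun q _ => ?_) fun _ _ => rfl
      constructor
      · intro H
        exact ⟨fun i h hi => H i h (by lia), H k0 hk le_rfl⟩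
      · rintro ⟨H1, H2⟩ i h hki
        rcases Nat.lt_or_ge k i with hlt | hge
        · exact H1 i h hlt
        · have : i = k0 := Fin.ext (le_antisymm hge hki)
          subst this
          exact H2
  rw [key ℓ, Finset.filter_true_of_mem]
  intro q _ i h hi
  lia

/-- The length of the row below row `r`, zero below the last row. -/
def nextRow (ℓ : ℕ) (lam : ℕ → ℕ) (r : ℕ) : ℕ := if r + 1 < ℓ then lam (r + 1) else 0

/-- The Jacobi–Trudi matrix with row lengths `q`, whose `i`-th row has generating series `P i`. -/
def jacobiTrudi (ℓ : ℕ) (P : ℕ → PowerSeries R) (q : Fin ℓ → ℤ) : Matrix (Fin ℓ) (Fin ℓ) R :=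
  Matrix.of fun i j => zcoeff (P i) (q i + ((j : ℤ) - (i : ℤ)))

theorem det_eq_of_unitriangular {ℓ : ℕ} (U A B : Matrix (Fin ℓ) (Fin ℓ) R)
    (hU : ∀ i j, j < i → U i j = 0) (hdiag : ∀ i, U i i = 1) (h : A = U * B) :
    A.det = B.det := by
  rw [h, Matrix.det_mul, Matrix.det_of_isUpperTriangular]
  · simp [hdiag]
  · intro i j hij
    exact hU i j hij

theorem det_jacobiTrudi_mul_geom (ℓ : ℕ) (lam : ℕ → ℕ)
    (hlam : ∀ a b : ℕ, a ≤ b → b < ℓ → lam b ≤ lam a) (P : ℕ → PowerSeries R)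
    (x : R) (t : ℕ → R) (hP : ∀ i, P (i + 1) = P i * geom (t (i + 1))) :
    ∑ q ∈ (Fintype.piFinset fun i : Fin ℓ => Finset.Icc (-(ℓ : ℤ)) (lam i)).filter
        (fun q => ∀ (i : Fin ℓ) (h : (i : ℕ) + 1 < ℓ), q ⟨i + 1, h⟩ ≤ q i),
      (∏ i : Fin ℓ, rowWeight x (t (i + 1)) (lam i) (nextRow ℓ lam i) (q i)) *
        (jacobiTrudi ℓ P q).det =
    (jacobiTrudi ℓ (fun i => P i * geom x) (fun i => lam i)).det := by
  have hnext : ∀ i : Fin ℓ, nextRow ℓ lam i ≤ lam i := by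
    intro i
    unfold nextRow
    split_ifs with h
    · exact hlam _ _ (Nat.le_succ _) h
    · exact Nat.zero_le _
  have H := sum_antitone_det_eq (-(ℓ : ℤ)) (fun i : Fin ℓ => (lam i : ℤ))
    (fun i u => rowWeight x (t (i + 1)) (lam i) (nextRow ℓ lam i) u)
    (fun i u j => zcoeff (P i) (u + ((j : ℤ) - (i : ℤ))))
    (fun i h => by exact_mod_cast hlam i (i + 1) (Nat.le_succ _) h) ?_
  · refine H.trans ?_
    refine det_eq_of_unitriangular (Matrix.of fun i j : Fin ℓ =>
      (if i = j then 1 else 0) + if (j : ℕ) = i + 1 then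
        x ^ ((lam i : ℤ) - nextRow ℓ lam i).toNat * (t (i + 1) - x) else 0) _ _ ?_ ?_ ?_
    · intro i j hij
      have h1 : ¬ i = j := fun h => by subst h; exact lt_irrefl _ hij
      have h2 : ¬ ((j : ℕ) = i + 1) := by have := Fin.lt_def.mp hij; lia
      simp [h1, h2]
    · intro i; simp
    · ext i j
      rw [Matrix.mul_apply, Matrix.of_apply, Finset.sum_apply]
      simp only [Pi.smul_apply, smul_eq_mul, Matrix.of_apply, jacobiTrudi, add_mul,
        Finset.sum_add_distrib, ite_mul, one_mul, zero_mul, Finset.sum_ite_eq, Finset.mem_univ,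
        if_true]
      rw [sum_rowWeight _ _ _ _ _ _ _ (by have := i.2; have := j.2; lia)
        (by lia) (by exact_mod_cast hnext i)]
      congr 1
      by_cases h : (i : ℕ) + 1 < ℓ
      · rw [Finset.sum_eq_single ⟨i + 1, h⟩]
        · simp only [if_true, hP, nextRow, h]
          congr 2
          push_cast
          ring
        · intro k _ hk
          rw [if_neg fun h' => hk (Fin.ext h')]
        · simp
      · rw [zcoeff_of_neg, Finset.sum_eq_zero]
        · simp
        · intro k _
          rw [if_neg]
          have := k.2; lia
        · have := j.2; have := i.2
          simp only [nextRow, h, if_false]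
          push_cast; lia
  · intro i h v hv1 hv2
    refine ⟨x ^ ((lam i : ℤ) - nextRow ℓ lam i).toNat *
      t (i + 1) ^ ((nextRow ℓ lam i : ℤ) - v + 1).toNat, ?_⟩
    ext j
    rw [Finset.sum_apply]
    simp only [Pi.smul_apply, smul_eq_mul]
    rw [sum_rowWeight_below _ _ _ _ _ _ _ _ (by have := i.2; have := j.2; lia) hv1
      (by simpa [nextRow, h] using hv2), ← hP]
    congr 2
    push_cast
    ring

theorem det_jacobiTrudi_one (ℓ : ℕ) (lam : ℕ → ℕ)
    (P : ℕ → PowerSeries R) (hP0 : P 0 = 1) (hP : ∀ i, PowerSeries.constantCoeff (P i) = 1)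
    (hlam : ∀ a b : ℕ, a ≤ b → b < ℓ → lam b ≤ lam a) :
    (jacobiTrudi ℓ P (fun i => lam i)).det = if ∀ i < ℓ, lam i = 0 then 1 else 0 := by
  split_ifs with h
  · rw [Matrix.det_of_isUpperTriangular]
    · refine Finset.prod_eq_one fun i _ => ?_
      simp [jacobiTrudi, h i i.2, zcoeff, hP]
    · intro i j hij
      have : (j : ℕ) < i := hij
      rw [jacobiTrudi, Matrix.of_apply, h i i.2, zcoeff_of_neg]
      push_cast; lia
  · push Not at h
    obtain ⟨i, hi, hne⟩ := h
    have h0 : lam 0 ≠ 0 := by have := hlam 0 i (Nat.zero_le _) hi; lia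
    refine Matrix.det_eq_zero_of_row_eq_zero ⟨0, by lia⟩ fun j => ?_
    have h1 : ((lam 0 : ℤ) + ((j : ℤ) - ((0 : ℕ) : ℤ))) = ((lam 0 + j : ℕ) : ℤ) := by
      push_cast; ring
    simp only [jacobiTrudi, Matrix.of_apply]
    rw [h1, zcoeff_natCast, hP0, PowerSeries.coeff_one, if_neg (by lia)]

theorem isSkewRPP_zero_iff {ℓ n : ℕ} {lam : ℕ → ℕ} {T : YBox ℓ lam → Fin (n + 1)} :
    IsSkewRPP ℓ n lam (fun _ => 0) T ↔
      (∀ b : YBox ℓ lam, (T b : ℕ) ≠ 0) ∧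
      (∀ (r : Fin ℓ) (c c' : Fin (lam r.1)), (c : ℕ) ≤ (c' : ℕ) → T ⟨r, c⟩ ≤ T ⟨r, c'⟩) ∧
      (∀ (r r' : Fin ℓ) (c : Fin (lam r.1)) (c' : Fin (lam r'.1)),
        (r : ℕ) ≤ (r' : ℕ) → (c : ℕ) = (c' : ℕ) → T ⟨r, c⟩ ≤ T ⟨r', c'⟩) := by
  simp [IsSkewRPP]

/-- Extend a filling of `mu` to a filling of `lam` by the largest entry outside `mu`. -/
def extendFilling {ℓ n : ℕ} {lam : ℕ → ℕ} (mu : ℕ → ℕ) (T : YBox ℓ mu → Fin (n + 1)) :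
    YBox ℓ lam → Fin (n + 2) :=
  fun b => if h : (b.2 : ℕ) < mu b.1 then (T ⟨b.1, ⟨b.2, h⟩⟩).castSucc else Fin.last (n + 1)

/-- The weight of a box carrying the largest entry. -/
def topWeight (ℓ : ℕ) (lam : ℕ → ℕ) (x : R) (t : ℕ → R) (r c : ℕ) : R :=
  if c < nextRow ℓ lam r then t (r + 1) else x

theorem lt_nextRow {ℓ : ℕ} {lam : ℕ → ℕ} {r c : ℕ} :
    c < nextRow ℓ lam r ↔ r + 1 < ℓ ∧ c < lam (r + 1) := by
  unfold nextRow; split_ifs with h <;> simp [h]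

theorem prod_topWeight (ℓ : ℕ) (lam : ℕ → ℕ) (x : R) (t : ℕ → R) (r m : ℕ)
    (hm : m ≤ lam r) (hn : nextRow ℓ lam r ≤ lam r) :
    ∏ c ∈ Finset.Ico m (lam r), topWeight ℓ lam x t r c =
      rowWeight x (t (r + 1)) (lam r) (nextRow ℓ lam r) m := by
  unfold topWeight rowWeight
  rw [Finset.prod_ite, Finset.prod_const, Finset.prod_const, mul_comm]
  have h1 : (Finset.Ico m (lam r)).filter (fun c => c < nextRow ℓ lam r) =
      Finset.Ico m (nextRow ℓ lam r) := by
    ext c; simp only [Finset.mem_filter, Finset.mem_Ico]; lia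
  have h2 : (Finset.Ico m (lam r)).filter (fun c => ¬ c < nextRow ℓ lam r) =
      Finset.Ico (max m (nextRow ℓ lam r)) (lam r) := by
    ext c; simp only [Finset.mem_filter, Finset.mem_Ico]; lia
  rw [h1, h2, Nat.card_Ico, Nat.card_Ico]
  congr 2 <;> lia

theorem prod_yBox_outside {ℓ : ℕ} {lam mu : ℕ → ℕ} (hle : ∀ r < ℓ, mu r ≤ lam r)
    (g : ℕ → ℕ → R) :
    ∏ b : YBox ℓ lam, (if (b.2 : ℕ) < mu b.1 then 1 else g b.1 b.2) =
      ∏ r : Fin ℓ, ∏ c ∈ Finset.Ico (mu r) (lam r), g r c := by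
  rw [Fintype.prod_sigma]
  refine Finset.prod_congr rfl fun r _ => ?_
  rw [Fin.prod_univ_eq_prod_range (fun c => if c < mu r then 1 else g r c) (lam r),
    Finset.prod_ite, Finset.prod_const_one, one_mul]
  refine Finset.prod_congr ?_ fun _ _ => rfl
  ext c
  have := hle r r.2
  simp only [Finset.mem_filter, Finset.mem_Ico, Finset.mem_range]; lia

theorem prod_yBox_inside {ℓ : ℕ} {lam mu : ℕ → ℕ} (hle : ∀ r < ℓ, mu r ≤ lam r)
    (f : YBox ℓ lam → R) :
    ∏ b : YBox ℓ lam, (if (b.2 : ℕ) < mu b.1 then f b else 1) =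
      ∏ b : YBox ℓ mu, f ⟨b.1, Fin.castLE (hle b.1 b.1.2) b.2⟩ := by
  symm
  refine Finset.prod_of_injOn (fun b : YBox ℓ mu => ⟨b.1, Fin.castLE (hle b.1 b.1.2) b.2⟩)
    ?_ (by simp) ?_ ?_
  · rintro ⟨r, c⟩ _ ⟨r', c'⟩ _ h
    simp only [Sigma.mk.injEq] at h
    obtain ⟨rfl, h⟩ := h
    simpa using h
  · rintro ⟨r, c⟩ _ h
    rw [if_neg]
    intro hc
    exact h ⟨⟨r, ⟨c, hc⟩⟩, by simp, rfl⟩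
  · rintro ⟨r, c⟩ _
    simp

theorem prod_boxWeight_extendFilling {ℓ n : ℕ} {lam mu : ℕ → ℕ}
    (hle : ∀ r < ℓ, mu r ≤ lam r)
    (hmu : ∀ a b : ℕ, a ≤ b → b < ℓ → mu b ≤ mu a) (x t : ℕ → R) (T : YBox ℓ mu → Fin (n + 1)) :
    ∏ b, boxWeight ℓ (n + 1) lam (fun _ => 0) x t (extendFilling mu T) b =
      (∏ r : Fin ℓ, ∏ c ∈ Finset.Ico (mu r) (lam r), topWeight ℓ lam (x (n + 1)) t r c) *
        ∏ b, boxWeight ℓ n mu (fun _ => 0) x t T b := by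
  have hsplit : ∀ b : YBox ℓ lam,
      boxWeight ℓ (n + 1) lam (fun _ => 0) x t (extendFilling mu T) b =
      (if (b.2 : ℕ) < mu b.1 then 1 else topWeight ℓ lam (x (n + 1)) t b.1 b.2) *
      (if (b.2 : ℕ) < mu b.1 then
        boxWeight ℓ (n + 1) lam (fun _ => 0) x t (extendFilling mu T) b else 1) := by
    rintro ⟨r, c⟩
    by_cases hc : (c : ℕ) < mu r
    · simp [hc]
    · simp only [hc, if_false, mul_one]
      simp only [boxWeight, Nat.zero_le, if_true, topWeight, lt_nextRow]
      have hlast : (extendFilling mu T : YBox ℓ lam → Fin (n + 2)) ⟨r, c⟩ = Fin.last (n + 1) := by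
        simp [extendFilling, hc]
      rw [hlast]
      by_cases h : (r : ℕ) + 1 < ℓ ∧ (c : ℕ) < lam (r + 1)
      · rw [if_pos h, if_pos]
        refine ⟨h.1, h.2, ?_⟩
        have := hmu r (r + 1) (Nat.le_succ _) h.1
        simp only [extendFilling]
        rw [dif_neg (by lia)]
      · rw [if_neg h, if_neg]
        · simp
        · rintro ⟨h1, h2, _⟩; exact h ⟨h1, h2⟩
  rw [Finset.prod_congr rfl fun b _ => hsplit b, Finset.prod_mul_distrib,
    prod_yBox_outside hle (topWeight ℓ lam (x (n + 1)) t), prod_yBox_inside hle]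
  congr 1
  refine Finset.prod_congr rfl fun b _ => ?_
  obtain ⟨r, c⟩ := b
  have hin : ∀ (r' : Fin ℓ) (c' : ℕ) (h : c' < lam r') (h' : c' < mu r'),
      (extendFilling mu T : YBox ℓ lam → Fin (n + 2)) ⟨r', ⟨c', h⟩⟩ =
        (T ⟨r', ⟨c', h'⟩⟩).castSucc := by
    intro r' c' h h'
    simp [extendFilling, h']
  have hc := hin r c (c.2.trans_le (hle r r.2)) c.2
  simp only [boxWeight, Nat.zero_le, if_true]
  have hc' : (extendFilling mu T : YBox ℓ lam → Fin (n + 2))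
      ⟨r, Fin.castLE (hle r r.2) c⟩ = (T ⟨r, c⟩).castSucc := hc
  rw [hc']
  have hiff : (∃ (hr : (r : ℕ) + 1 < ℓ) (hc : ((Fin.castLE (hle r r.2) c : Fin _) : ℕ) < lam (r + 1)),
      (extendFilling mu T : YBox ℓ lam → Fin (n + 2)) ⟨⟨r + 1, hr⟩, ⟨Fin.castLE (hle r r.2) c, hc⟩⟩ =
        (T ⟨r, c⟩).castSucc) ↔
      ∃ (hr : (r : ℕ) + 1 < ℓ) (hc : (c : ℕ) < mu (r + 1)),
        T ⟨⟨r + 1, hr⟩, ⟨c, hc⟩⟩ = T ⟨r, c⟩ := by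
    constructor
    · rintro ⟨hr, h1, h2⟩
      refine ⟨hr, ?_⟩
      by_cases h3 : (c : ℕ) < mu (r + 1)
      · refine ⟨h3, ?_⟩
        have := hin ⟨r + 1, hr⟩ c h1 h3
        rw [show (⟨⟨r + 1, hr⟩, ⟨Fin.castLE (hle r r.2) c, h1⟩⟩ : YBox ℓ lam) =
          ⟨⟨r + 1, hr⟩, ⟨c, h1⟩⟩ from rfl, this] at h2
        exact Fin.castSucc_injective _ h2
      · exfalso
        have h4 : (extendFilling mu T : YBox ℓ lam → Fin (n + 2))
            ⟨⟨r + 1, hr⟩, ⟨Fin.castLE (hle r r.2) c, h1⟩⟩ = Fin.last (n + 1) := by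
          simp [extendFilling, h3]
        rw [h4] at h2
        exact (Fin.castSucc_lt_last _).ne h2.symm
    · rintro ⟨hr, h1, h2⟩
      refine ⟨hr, h1.trans_le (hle _ hr), ?_⟩
      rw [← h2]
      exact hin ⟨r + 1, hr⟩ c _ h1
  by_cases h : ∃ (hr : (r : ℕ) + 1 < ℓ) (hc : (c : ℕ) < mu (r + 1)),
        T ⟨⟨r + 1, hr⟩, ⟨c, hc⟩⟩ = T ⟨r, c⟩
  · rw [if_pos h, if_pos (hiff.mpr h)]
  · rw [if_neg h, if_neg fun h' => h (hiff.mp h')]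
    simp

theorem sum_rpp_of_shape {ℓ n : ℕ} {lam mu : ℕ → ℕ} (hle : ∀ r < ℓ, mu r ≤ lam r)
    (hmu : ∀ a b : ℕ, a ≤ b → b < ℓ → mu b ≤ mu a) (x t : ℕ → R) :
    ∑ T ∈ (Finset.univ.filter (IsSkewRPP ℓ (n + 1) lam (fun _ => 0))).filter
        (fun T => ∀ b, (T b : ℕ) ≤ n ↔ (b.2 : ℕ) < mu b.1),
      ∏ b, boxWeight ℓ (n + 1) lam (fun _ => 0) x t T b =
    (∏ r : Fin ℓ, ∏ c ∈ Finset.Ico (mu r) (lam r), topWeight ℓ lam (x (n + 1)) t r c) *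
      dualGroth ℓ n mu (fun _ => 0) x t := by
  rw [dualGroth, Finset.mul_sum]
  symm
  refine Finset.sum_bij (fun T _ => extendFilling mu T) ?_ ?_ ?_ ?_
  · intro T hT
    rw [Finset.mem_filter, isSkewRPP_zero_iff] at hT
    obtain ⟨_, h0, hrow, hcol⟩ := hT
    rw [Finset.mem_filter, Finset.mem_filter, isSkewRPP_zero_iff]
    refine ⟨⟨Finset.mem_univ _, fun b => ?_, fun r c c' h => ?_, fun r r' c c' h h' => ?_⟩,
      fun b => ?_⟩
    · unfold extendFilling
      split_ifs with hb
      · simpa using h0 _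
      · simp
    · unfold extendFilling
      dsimp only
      split_ifs with h1 h2
      · exact Fin.castSucc_le_castSucc_iff.mpr (hrow _ _ _ h)
      · exact Fin.le_last _
      · lia
      · exact le_rfl
    · unfold extendFilling
      dsimp only
      have := hmu r r' h r'.2
      split_ifs with h1 h2
      · exact Fin.castSucc_le_castSucc_iff.mpr (hcol _ _ _ _ h h')
      · exact Fin.le_last _
      · lia
      · exact le_rfl
    · unfold extendFilling
      split_ifs with hb
      · simp only [Fin.val_castSucc, hb, iff_true]
        exact Nat.lt_succ_iff.mp (Fin.is_lt _)
      · simp [hb]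
  · intro T _ T' _ h
    ext ⟨r, c⟩
    have h1 := congrFun h ⟨r, Fin.castLE (hle r r.2) c⟩
    simpa [extendFilling, Fin.ext_iff] using h1
  · intro T hT
    rw [Finset.mem_filter, Finset.mem_filter, isSkewRPP_zero_iff] at hT
    obtain ⟨⟨_, h0, hrow, hcol⟩, hsh⟩ := hT
    refine ⟨fun b => ⟨T ⟨b.1, Fin.castLE (hle b.1 b.1.2) b.2⟩,
      Nat.lt_succ_iff.mpr ((hsh _).mpr b.2.2)⟩, ?_, ?_⟩
    · rw [Finset.mem_filter, isSkewRPP_zero_iff]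
      exact ⟨Finset.mem_univ _, fun b => h0 _, fun r c c' h => hrow _ _ _ h,
        fun r r' c c' h h' => hcol _ _ _ _ h h'⟩
    · ext ⟨r, c⟩
      unfold extendFilling
      split_ifs with hb
      · rfl
      · have h1 := mt (hsh ⟨r, c⟩).mp hb
        have h2 := (T ⟨r, c⟩).2
        simp only [Fin.val_last]
        lia
  · intro T _
    exact (prod_boxWeight_extendFilling hle hmu x t T).symm

theorem dualGroth_zero (ℓ : ℕ) (lam : ℕ → ℕ) (x t : ℕ → R) :
    dualGroth ℓ 0 lam (fun _ => 0) x t = if ∀ i < ℓ, lam i = 0 then 1 else 0 := by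
  unfold dualGroth
  split_ifs with h
  · have hE : IsEmpty (YBox ℓ lam) := ⟨fun b => by
      have h1 := b.2.2
      have h2 := h b.1 b.1.2
      lia⟩
    rw [Finset.filter_true_of_mem]
    · simp
    · intro T _
      rw [isSkewRPP_zero_iff]
      exact ⟨fun b => (hE.false b).elim, fun r c => (hE.false ⟨r, c⟩).elim,
        fun r _ c => (hE.false ⟨r, c⟩).elim⟩
  · push Not at h
    obtain ⟨i, hi, hne⟩ := h
    refine Finset.sum_eq_zero fun T hT => ?_
    rw [Finset.mem_filter, isSkewRPP_zero_iff] at hT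
    exact absurd (by have := (T ⟨⟨i, hi⟩, ⟨0, Nat.pos_of_ne_zero hne⟩⟩).2; lia)
      (hT.2.1 ⟨⟨i, hi⟩, ⟨0, Nat.pos_of_ne_zero hne⟩⟩)

/-- The shape formed by the entries of a filling that are at most `n`. -/
def subshape {ℓ n : ℕ} {lam : ℕ → ℕ} (T : YBox ℓ lam → Fin (n + 2)) (r : Fin ℓ) : ℕ :=
  (Finset.univ.filter fun c : Fin (lam r) => (T ⟨r, c⟩ : ℕ) ≤ n).card

theorem lt_subshape_iff {ℓ n : ℕ} {lam : ℕ → ℕ} {T : YBox ℓ lam → Fin (n + 2)}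
    (hT : IsSkewRPP ℓ (n + 1) lam (fun _ => 0) T) (r : Fin ℓ) (c : Fin (lam r)) :
    (c : ℕ) < subshape T r ↔ (T ⟨r, c⟩ : ℕ) ≤ n := by
  rw [isSkewRPP_zero_iff] at hT
  constructor
  · intro h
    by_contra hc
    have hsub : (Finset.univ.filter fun c : Fin (lam r) => (T ⟨r, c⟩ : ℕ) ≤ n) ⊆
        Finset.Iio c := by
      intro d hd
      rw [Finset.mem_filter] at hd
      rw [Finset.mem_Iio]
      by_contra hdc
      exact hc (le_trans (Fin.le_def.mp (hT.2.1 r c d (not_lt.mp hdc))) hd.2)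
    have := Finset.card_le_card hsub
    rw [Fin.card_Iio] at this
    exact absurd h (not_lt.mpr this)
  · intro h
    have hsub : Finset.Iic c ⊆
        (Finset.univ.filter fun c : Fin (lam r) => (T ⟨r, c⟩ : ℕ) ≤ n) := by
      intro d hd
      rw [Finset.mem_Iic] at hd
      rw [Finset.mem_filter]
      exact ⟨Finset.mem_univ _, le_trans (Fin.le_def.mp (hT.2.1 r d c hd)) h⟩
    have := Finset.card_le_card hsub
    rw [Fin.card_Iic] at this
    exact this

theorem subshape_le {ℓ n : ℕ} {lam : ℕ → ℕ} (T : YBox ℓ lam → Fin (n + 2)) (r : Fin ℓ) :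
    subshape T r ≤ lam r := by
  simpa [subshape] using Finset.card_filter_le (Finset.univ : Finset (Fin (lam r)))
    fun c => (T ⟨r, c⟩ : ℕ) ≤ n

theorem subshape_antitone {ℓ n : ℕ} {lam : ℕ → ℕ} {T : YBox ℓ lam → Fin (n + 2)}
    (hlam : ∀ a b : ℕ, a ≤ b → b < ℓ → lam b ≤ lam a)
    (hT : IsSkewRPP ℓ (n + 1) lam (fun _ => 0) T) (r s : Fin ℓ) (hrs : r ≤ s) :
    subshape T s ≤ subshape T r := by
  by_contra! h
  have h1 : subshape T r < lam s := h.trans_le (subshape_le T s)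
  have h2 : subshape T r < lam r := h1.trans_le (hlam r s hrs s.2)
  have h3 := (lt_subshape_iff hT s ⟨_, h1⟩).mp h
  have h4 := (isSkewRPP_zero_iff.mp hT).2.2 r s ⟨_, h2⟩ ⟨_, h1⟩ hrs rfl
  exact lt_irrefl _ ((lt_subshape_iff hT r ⟨_, h2⟩).mpr (le_trans (Fin.le_def.mp h4) h3))

/-- The generating series of the complete homogeneous symmetric functions of the alphabet
`x 1, …, x n, t 1, …, t i`. -/
def flaggedSeries (n : ℕ) (x t : ℕ → R) (i : ℕ) : PowerSeries R :=
  (∏ a ∈ Finset.Icc 1 n, geom (x a)) * ∏ b ∈ Finset.Icc 1 i, geom (t b)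

theorem constantCoeff_geom (a : R) : PowerSeries.constantCoeff (geom a) = 1 := by
  rw [← PowerSeries.coeff_zero_eq_constantCoeff_apply]
  simp [geom]

/-- The Jacobi–Trudi formula for refined dual Grothendieck polynomials. -/
theorem dualGroth_eq_det (ℓ n : ℕ) (lam : ℕ → ℕ)
    (hlam : ∀ a b : ℕ, a ≤ b → b < ℓ → lam b ≤ lam a) (x t : ℕ → R) :
    dualGroth ℓ n lam (fun _ => 0) x t =
      (jacobiTrudi ℓ (flaggedSeries n x t) (fun i => lam i)).det := by
  induction n generalizing lam with
  | zero =>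
    rw [dualGroth_zero, det_jacobiTrudi_one ℓ lam _ (by simp [flaggedSeries]) _ hlam]
    intro i
    simp [flaggedSeries, constantCoeff_geom]
  | succ n ih =>
    have hF : flaggedSeries (n + 1) x t = fun i => flaggedSeries n x t i * geom (x (n + 1)) := by
      ext1 i
      rw [flaggedSeries, flaggedSeries, Finset.prod_Icc_succ_top (by lia)]
      ring
    rw [hF, ← det_jacobiTrudi_mul_geom ℓ lam hlam (flaggedSeries n x t) (x (n + 1)) t]
    swap
    · intro i
      rw [flaggedSeries, flaggedSeries, Finset.prod_Icc_succ_top (by lia), mul_assoc]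
    rw [dualGroth, ← Finset.sum_fiberwise_of_maps_to
      (g := fun T (r : Fin ℓ) => (subshape T r : ℤ))
      (t := (Fintype.piFinset fun i : Fin ℓ => Finset.Icc (-(ℓ : ℤ)) (lam i)).filter
        (fun q => ∀ (i : Fin ℓ) (h : (i : ℕ) + 1 < ℓ), q ⟨i + 1, h⟩ ≤ q i))]
    swap
    · intro T hT
      rw [Finset.mem_filter] at hT
      rw [Finset.mem_filter, Fintype.mem_piFinset]
      refine ⟨fun i => ?_, fun i h => ?_⟩
      · rw [Finset.mem_Icc]
        have := subshape_le T i
        lia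
      · change (subshape T _ : ℤ) ≤ subshape T _
        exact_mod_cast subshape_antitone hlam hT.2 i ⟨i + 1, h⟩ (Fin.le_def.mpr (Nat.le_succ _))
    refine Finset.sum_congr rfl fun q hq => ?_
    rw [Finset.mem_filter, Fintype.mem_piFinset] at hq
    obtain ⟨hbox, hchain⟩ := hq
    have hanti : ∀ (b : ℕ) (hb : b < ℓ) (a : ℕ) (hab : a ≤ b),
        q ⟨b, hb⟩ ≤ q ⟨a, hab.trans_lt hb⟩ := by
      intro b hb a hab
      induction b, hab using Nat.le_induction with
      | base => exact le_rfl
      | succ b hab ihb => exact (hchain ⟨b, by lia⟩ hb).trans (ihb (by lia))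
    by_cases hneg : ∃ i, q i < 0
    · obtain ⟨i, hi⟩ := hneg
      have h0 : 0 < ℓ := lt_of_le_of_lt (Nat.zero_le _) i.2
      have hlast := hanti (ℓ - 1) (by lia) i (by have := i.2; lia)
      have hdet : (jacobiTrudi ℓ (flaggedSeries n x t) q).det = 0 := by
        refine Matrix.det_eq_zero_of_row_eq_zero ⟨ℓ - 1, by lia⟩ fun j => ?_
        rw [jacobiTrudi, Matrix.of_apply, zcoeff_of_neg]
        have := j.2
        have h2 : q ⟨ℓ - 1, by lia⟩ < 0 := lt_of_le_of_lt hlast hi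
        dsimp only
        lia
      rw [hdet, mul_zero, Finset.filter_false_of_mem, Finset.sum_empty]
      intro T _ hT
      have : (subshape T i : ℤ) = q i := congrFun hT i
      lia
    · push Not at hneg
      set mu : ℕ → ℕ := fun r => if h : r < ℓ then (q ⟨r, h⟩).toNat else 0 with hmu
      have hmuq : ∀ i : Fin ℓ, (mu i : ℤ) = q i := by
        intro i
        simp [hmu, hneg i]
      have hmuanti : ∀ a b : ℕ, a ≤ b → b < ℓ → mu b ≤ mu a := by
        intro a b hab hb
        have h1 := hanti b hb a hab
        have h2 := hmuq ⟨b, hb⟩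
        have h3 := hmuq ⟨a, hab.trans_lt hb⟩
        dsimp only at h2 h3
        lia
      have hle : ∀ r < ℓ, mu r ≤ lam r := by
        intro r hr
        have h1 := (Finset.mem_Icc.mp (hbox ⟨r, hr⟩)).2
        have h2 := hmuq ⟨r, hr⟩
        dsimp only at h1 h2
        lia
      have hnext : ∀ r < ℓ, nextRow ℓ lam r ≤ lam r := by
        intro r _
        unfold nextRow
        split_ifs with h
        · exact hlam _ _ (Nat.le_succ _) h
        · exact Nat.zero_le _
      have hset : (Finset.univ.filter (IsSkewRPP ℓ (n + 1) lam fun _ => 0)).filter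
            (fun T => (fun r : Fin ℓ => (subshape T r : ℤ)) = q) =
          (Finset.univ.filter (IsSkewRPP ℓ (n + 1) lam fun _ => 0)).filter
            (fun T => ∀ b, (T b : ℕ) ≤ n ↔ (b.2 : ℕ) < mu b.1) := by
        refine Finset.filter_congr fun T hT => ?_
        have hT := (Finset.mem_filter.mp hT).2
        constructor
        · rintro h ⟨r, c⟩
          rw [← lt_subshape_iff hT r c]
          have h1 := congrFun h r
          have h2 := hmuq r
          dsimp only at h1 ⊢
          rw [show subshape T r = mu r by lia]
        · intro h
          ext r
          rw [← hmuq r]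
          have h1 := subshape_le T r
          have h2 := hle r r.2
          rcases lt_trichotomy (subshape T r) (mu r) with h3 | h3 | h3
          · have h4 := (h ⟨r, ⟨subshape T r, h3.trans_le h2⟩⟩).mpr h3
            exact absurd ((lt_subshape_iff hT r ⟨subshape T r, h3.trans_le h2⟩).mpr h4)
              (lt_irrefl _)
          · rw [h3]
          · have h4 := (lt_subshape_iff hT r ⟨mu r, h3.trans_le h1⟩).mp h3
            exact absurd ((h ⟨r, ⟨mu r, h3.trans_le h1⟩⟩).mp h4) (lt_irrefl _)
      rw [hset, sum_rpp_of_shape hle hmuanti, ih mu hmuanti,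
        show (fun i : Fin ℓ => (mu i : ℤ)) = q from funext hmuq]
      congr 1
      refine Finset.prod_congr rfl fun r _ => ?_
      rw [prod_topWeight ℓ lam _ t r (mu r) (hle r r.2) (hnext r r.2), hmuq]

theorem zcoeff_mul (P Q : PowerSeries R) (m : ℤ) (M : ℕ)
    (h : ∀ q : ℕ, M ≤ q → PowerSeries.coeff q Q = 0 ∨ m < q) :
    zcoeff (P * Q) m = ∑ q ∈ Finset.range M, PowerSeries.coeff q Q * zcoeff P (m - q) := by
  rcases lt_or_ge m 0 with hm | hm
  · rw [zcoeff_of_neg _ hm]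
    refine (Finset.sum_eq_zero fun q _ => ?_).symm
    rw [zcoeff_of_neg _ (by lia), mul_zero]
  obtain ⟨k, rfl⟩ := Int.eq_ofNat_of_zero_le hm
  have hzero : ∀ q, q ∉ Finset.range M →
      PowerSeries.coeff q Q * zcoeff P ((k : ℤ) - q) = 0 := by
    intro q hq
    rw [Finset.mem_range, not_lt] at hq
    rcases h q hq with h1 | h1
    · rw [h1, zero_mul]
    · rw [zcoeff_of_neg _ (by lia), mul_zero]
  have hzero' : ∀ q, q ∉ Finset.range (k + 1) →
      PowerSeries.coeff q Q * zcoeff P ((k : ℤ) - q) = 0 := by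
    intro q hq
    rw [Finset.mem_range, not_lt] at hq
    rw [zcoeff_of_neg _ (by lia), mul_zero]
  rw [zcoeff_natCast, mul_comm, PowerSeries.coeff_mul,
    Finset.Nat.sum_antidiagonal_eq_sum_range_succ
      (fun a b => PowerSeries.coeff a Q * PowerSeries.coeff b P)]
  have h1 : ∑ q ∈ Finset.range (k + 1), PowerSeries.coeff q Q * PowerSeries.coeff (k - q) P =
      ∑ q ∈ Finset.range (k + 1), PowerSeries.coeff q Q * zcoeff P ((k : ℤ) - q) := by
    refine Finset.sum_congr rfl fun q hq => ?_
    rw [Finset.mem_range] at hq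
    rw [show (k : ℤ) - q = ((k - q : ℕ) : ℤ) by lia, zcoeff_natCast]
  rw [h1]
  trans ∑ q ∈ Finset.range (k + 1) ∪ Finset.range M,
    PowerSeries.coeff q Q * zcoeff P ((k : ℤ) - q)
  · exact Finset.sum_subset Finset.subset_union_left fun q _ hq => hzero' q hq
  · exact (Finset.sum_subset Finset.subset_union_right fun q _ hq => hzero q hq).symm

theorem coeff_prod_one_sub_eq_zero (s : Finset ℕ) (t : ℕ → R) (q : ℕ) (hq : s.card < q) :
    PowerSeries.coeff q (∏ b ∈ s, (1 - PowerSeries.C (t b) * PowerSeries.X)) = 0 := by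
  induction s using Finset.induction_on generalizing q with
  | empty =>
    rw [Finset.prod_empty, PowerSeries.coeff_one, if_neg]
    simp at hq; lia
  | insert b s hb ih =>
    rw [Finset.card_insert_of_notMem hb] at hq
    obtain ⟨p, rfl⟩ : ∃ p, q = p + 1 := ⟨q - 1, by lia⟩
    rw [Finset.prod_insert hb, sub_mul, one_mul, map_sub, ih _ (by lia), mul_assoc,
      PowerSeries.coeff_C_mul, mul_comm PowerSeries.X, PowerSeries.coeff_succ_mul_X,
      ih _ (by lia)]
    simp

theorem geom_mul_one_sub (a : R) :
    geom a * (1 - PowerSeries.C a * PowerSeries.X) = 1 := by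
  linear_combination geom_eq a

/-- Rows of equal length of a flagged Jacobi–Trudi determinant may use a common alphabet. -/
theorem det_jacobiTrudi_flat (ℓ k : ℕ) (hk : 1 ≤ k) (hkl : k ≤ ℓ) (lam : ℕ → ℕ)
    (hflat : ∀ a : ℕ, a < k → lam a = lam 0) (P : PowerSeries R) (t : ℕ → R) :
    (jacobiTrudi ℓ (fun i => P * ∏ b ∈ Finset.Icc 1 i, geom (t b)) (fun i => lam i)).det =
      (jacobiTrudi ℓ (fun i => P * (∏ b ∈ Finset.Icc 1 (k - 1), geom (t b)) *
        ∏ b ∈ Finset.Ico k (i + 1), geom (t b)) (fun i => lam i)).det := by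
  set E : ℕ → PowerSeries R := fun i =>
    ∏ b ∈ Finset.Ico (i + 1) k, (1 - PowerSeries.C (t b) * PowerSeries.X) with hE
  set B : ℕ → PowerSeries R := fun i => P * (∏ b ∈ Finset.Icc 1 (k - 1), geom (t b)) *
    ∏ b ∈ Finset.Ico k (i + 1), geom (t b) with hB
  have hAB : ∀ i, P * ∏ b ∈ Finset.Icc 1 i, geom (t b) = B i * E i := by
    intro i
    simp only [hB, hE]
    rcases lt_or_ge i k with hik | hik
    · have hs : Finset.Icc 1 (k - 1) = Finset.Icc 1 i ∪ Finset.Ico (i + 1) k := by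
        ext b; simp only [Finset.mem_union, Finset.mem_Icc, Finset.mem_Ico]; lia
      have hd : Disjoint (Finset.Icc 1 i) (Finset.Ico (i + 1) k) := by
        rw [Finset.disjoint_left]; intro b; simp only [Finset.mem_Icc, Finset.mem_Ico]; lia
      have hone : (∏ b ∈ Finset.Ico (i + 1) k, geom (t b)) *
          ∏ b ∈ Finset.Ico (i + 1) k, (1 - PowerSeries.C (t b) * PowerSeries.X) = 1 := by
        rw [← Finset.prod_mul_distrib]
        exact Finset.prod_eq_one fun b _ => geom_mul_one_sub _
      rw [Finset.Ico_eq_empty_of_le (show i + 1 ≤ k by lia), Finset.prod_empty, hs,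
        Finset.prod_union hd]
      linear_combination (-P * ∏ b ∈ Finset.Icc 1 i, geom (t b)) * hone
    · have hs : Finset.Icc 1 i = Finset.Icc 1 (k - 1) ∪ Finset.Ico k (i + 1) := by
        ext b; simp only [Finset.mem_union, Finset.mem_Icc, Finset.mem_Ico]; lia
      have hd : Disjoint (Finset.Icc 1 (k - 1)) (Finset.Ico k (i + 1)) := by
        rw [Finset.disjoint_left]; intro b; simp only [Finset.mem_Icc, Finset.mem_Ico]; lia
      rw [Finset.Ico_eq_empty_of_le (show k ≤ i + 1 by lia), Finset.prod_empty, hs,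
        Finset.prod_union hd]
      ring
  have hEzero : ∀ i q : ℕ, q ≠ 0 → k ≤ i + q → PowerSeries.coeff q (E i) = 0 := by
    intro i q hq hiq
    refine coeff_prod_one_sub_eq_zero _ _ _ ?_
    rw [Nat.card_Ico]; lia
  have hEone : ∀ i, PowerSeries.coeff 0 (E i) = 1 := by
    intro i
    simp [hE, map_prod]
  refine det_eq_of_unitriangular (Matrix.of fun i j : Fin ℓ =>
    if (i : ℕ) ≤ j then PowerSeries.coeff (j - i : ℕ) (E i) else 0) _ _ ?_ ?_ ?_
  · intro i j hij
    rw [Matrix.of_apply, if_neg (not_le.mpr (Fin.lt_def.mp hij))]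
  · intro i
    simp [hEone]
  · ext i j
    rw [Matrix.mul_apply]
    simp only [jacobiTrudi, Matrix.of_apply]
    rw [hAB, zcoeff_mul _ _ _ (ℓ - i), Fin.sum_univ_eq_sum_range (fun r =>
      (if (i : ℕ) ≤ r then PowerSeries.coeff (r - i : ℕ) (E i) else 0) *
        zcoeff (B r) ((lam r : ℤ) + ((j : ℤ) - (r : ℤ)))) ℓ]
    · have hsplit : Finset.range ℓ = Finset.range ((i : ℕ) + (ℓ - i)) := by
        rw [Nat.add_sub_cancel' i.2.le]
      rw [hsplit, Finset.sum_range_add, Finset.sum_eq_zero (s := Finset.range i), zero_add]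
      · refine Finset.sum_congr rfl fun q _ => ?_
        rw [if_pos (Nat.le_add_right _ _), Nat.add_sub_cancel_left]
        by_cases hq : q = 0
        · subst hq; simp
        by_cases hiq : k ≤ i + q
        · rw [hEzero _ _ hq hiq]; simp
        · have hBB : B (i + q) = B i := by
            simp only [hB]
            rw [Finset.Ico_eq_empty_of_le (show (i : ℕ) + q + 1 ≤ k by lia),
              Finset.Ico_eq_empty_of_le (show (i : ℕ) + 1 ≤ k by lia)]
          rw [hBB, hflat i (by lia), hflat (i + q) (by lia)]
          congr 2
          push_cast; ring
      · intro r hr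
        rw [Finset.mem_range] at hr
        rw [if_neg (by lia), zero_mul]
    · intro q hq
      left
      have := i.2
      exact hEzero _ _ (by lia) (by lia)

/-- The `q`-th smallest element of a finite set of natural numbers. -/
def nthElement (S : Finset ℕ) (q : ℕ) : ℕ := (S.sort (· ≤ ·)).getD q 0

theorem nthElement_eq {ℓ : ℕ} {S : Finset ℕ} (hS : S.card = ℓ) (q : Fin ℓ) :
    nthElement S q = S.orderEmbOfFin hS q := by
  rw [Finset.orderEmbOfFin_apply, nthElement, List.getD_eq_getElem]
  rfl

theorem nthElement_injective {ℓ : ℕ} {S : Finset ℕ} (hS : S.card = ℓ) :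
    Function.Injective fun q : Fin ℓ => nthElement S q := by
  intro p q h
  simp only [nthElement_eq hS] at h
  exact (S.orderEmbOfFin hS).injective h

theorem nthElement_mem {ℓ : ℕ} {S : Finset ℕ} (hS : S.card = ℓ) (q : Fin ℓ) :
    nthElement S q ∈ S := by
  rw [nthElement_eq hS]; exact Finset.orderEmbOfFin_mem _ _ _

theorem image_nthElement {ℓ : ℕ} {S : Finset ℕ} (hS : S.card = ℓ) :
    Finset.univ.image (fun q : Fin ℓ => nthElement S q) = S := by
  refine Finset.eq_of_subset_of_card_le ?_ ?_
  · intro a ha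
    obtain ⟨q, _, rfl⟩ := Finset.mem_image.mp ha
    exact nthElement_mem hS q
  · rw [Finset.card_image_of_injective _ (nthElement_injective hS), hS]; simp

theorem prod_nthElement {ℓ : ℕ} {S : Finset ℕ} (hS : S.card = ℓ) (f : ℕ → R) :
    ∏ q : Fin ℓ, f (nthElement S q) = ∏ a ∈ S, f a := by
  conv_rhs => rw [← image_nthElement hS]
  rw [Finset.prod_image fun p _ q _ h => nthElement_injective hS h]

theorem sum_nthElement {ℓ : ℕ} {S : Finset ℕ} (hS : S.card = ℓ) (f : ℕ → R) :
    ∑ q : Fin ℓ, f (nthElement S q) = ∑ a ∈ S, f a := by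
  conv_rhs => rw [← image_nthElement hS]
  rw [Finset.sum_image fun p _ q _ h => nthElement_injective hS h]

/-- The Cauchy–Binet formula. -/
theorem det_sum_mul (ℓ : ℕ) (I : Finset ℕ) (A : Fin ℓ → ℕ → R) (B : ℕ → Fin ℓ → R) :
    (Matrix.of fun i j => ∑ a ∈ I, A i a * B a j).det =
      ∑ S ∈ Finset.powersetCard ℓ I,
        (Matrix.of fun i q : Fin ℓ => A i (nthElement S q)).det *
          (Matrix.of fun q j : Fin ℓ => B (nthElement S q) j).det := by
  set f : (Fin ℓ → ℕ) → R := fun g => (∏ i, A i (g i)) * (Matrix.of fun i => B (g i)).det with hf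
  have hall : (Matrix.of fun i j => ∑ a ∈ I, A i a * B a j).det =
      ∑ g ∈ Fintype.piFinset fun _ : Fin ℓ => I, f g := by
    have h := (Matrix.detRowAlternating (R := R) (n := Fin ℓ)).toMultilinearMap.map_sum_finset
      (fun i a => A i a • B a) (fun _ => I)
    have h1 : (Matrix.of fun i j => ∑ a ∈ I, A i a * B a j) =
        fun i => ∑ a ∈ I, A i a • B a := by
      ext i j
      simp [Finset.sum_apply]
    rw [h1]
    refine Eq.trans h (Finset.sum_congr rfl fun g _ => ?_)
    exact (Matrix.detRowAlternating (R := R) (n := Fin ℓ)).toMultilinearMap.map_smul_univ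
      (fun i => A i (g i)) (fun i => B (g i))
  have hinj : ∑ g ∈ Fintype.piFinset fun _ : Fin ℓ => I, f g =
      ∑ g ∈ (Fintype.piFinset fun _ : Fin ℓ => I).filter Function.Injective, f g := by
    refine (Finset.sum_filter_of_ne fun g _ hg => ?_).symm
    by_contra hni
    obtain ⟨p, q, hpq, hne⟩ := Function.not_injective_iff.mp hni
    refine hg ?_
    rw [hf]
    dsimp only
    rw [Matrix.det_zero_of_row_eq hne, mul_zero]
    exact congrArg B hpq
  rw [hall, hinj, ← Finset.sum_fiberwise_of_maps_to (g := fun g => Finset.univ.image g)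
    (t := Finset.powersetCard ℓ I)]
  · refine Finset.sum_congr rfl fun S hS => ?_
    obtain ⟨hSI, hSc⟩ := Finset.mem_powersetCard.mp hS
    rw [← Matrix.det_transpose, Matrix.det_apply', Finset.sum_mul]
    symm
    refine Finset.sum_bij (fun σ _ => fun i => nthElement S (σ i)) ?_ ?_ ?_ ?_
    · intro σ _
      rw [Finset.mem_filter, Finset.mem_filter, Fintype.mem_piFinset]
      refine ⟨⟨fun i => hSI (nthElement_mem hSc _),
        (nthElement_injective hSc).comp σ.injective⟩, ?_⟩
      conv_rhs => rw [← image_nthElement hSc]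
      ext a
      simp only [Finset.mem_image, Finset.mem_univ, true_and]
      exact ⟨fun ⟨i, hi⟩ => ⟨σ i, hi⟩, fun ⟨i, hi⟩ => ⟨σ.symm i, by simpa using hi⟩⟩
    · intro σ _ τ _ h
      ext i : 1
      exact nthElement_injective hSc (congrFun h i)
    · intro g hg
      rw [Finset.mem_filter, Finset.mem_filter] at hg
      obtain ⟨⟨_, hgi⟩, him⟩ := hg
      have hex : ∀ i, ∃ q : Fin ℓ, nthElement S q = g i := by
        intro i
        have h1 : g i ∈ S := him ▸ Finset.mem_image_of_mem _ (Finset.mem_univ i)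
        rw [← image_nthElement hSc] at h1
        obtain ⟨q, _, hq⟩ := Finset.mem_image.mp h1
        exact ⟨q, hq⟩
      choose σ hσ using hex
      have hσi : Function.Injective σ := fun i j h => hgi (by rw [← hσ i, ← hσ j, h])
      exact ⟨Equiv.ofBijective σ (Finite.injective_iff_bijective.mp hσi), Finset.mem_univ _,
        funext hσ⟩
    · intro σ _
      have h1 : (Matrix.of fun i => B (nthElement S (σ i))) =
          (Matrix.of fun q j : Fin ℓ => B (nthElement S q) j).submatrix σ id := rfl
      rw [hf]
      dsimp only
      rw [h1, Matrix.det_permute]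
      simp only [Matrix.transpose_apply, Matrix.of_apply]
      ring
  · intro g hg
    rw [Finset.mem_filter, Fintype.mem_piFinset] at hg
    rw [Finset.mem_powersetCard]
    refine ⟨fun a ha => ?_, ?_⟩
    · obtain ⟨i, _, rfl⟩ := Finset.mem_image.mp ha
      exact hg.1 i
    · rw [Finset.card_image_of_injective _ hg.2]; simp

section Field

variable {F : Type*} [Field F]

theorem sum_nodalWeight_eq_zero (I : Finset ℕ) (X : ℕ → F) (hX : Set.InjOn X I)
    (hI : 1 < I.card) : ∑ a ∈ I, Lagrange.nodalWeight I X a = 0 := by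
  have h := Lagrange.coeff_eq_sum hX (P := 1)
    (by rw [Polynomial.degree_one]; exact_mod_cast (by lia : 0 < I.card))
  rw [Polynomial.coeff_one, if_neg (by lia)] at h
  rw [h]
  refine Finset.sum_congr rfl fun a _ => ?_
  simp [Lagrange.nodalWeight]

theorem zcoeff_prod_geom (I : Finset ℕ) (X : ℕ → F) (hX : Set.InjOn X I)
    (hI : I.Nonempty) (p : ℕ) :
    zcoeff (∏ a ∈ I, geom (X a)) ((p : ℤ) + 1 - I.card) =
      ∑ a ∈ I, Lagrange.nodalWeight I X a * X a ^ p := by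
  induction hI using Finset.Nonempty.cons_induction generalizing p with
  | singleton a =>
    simp [Lagrange.nodalWeight, zcoeff_natCast, geom]
  | cons b I hb hI ih =>
    have hXI : Set.InjOn X I := hX.mono (by simp)
    have hcard : 1 ≤ I.card := Finset.card_pos.mpr hI
    rw [Finset.prod_cons, mul_comm, zcoeff_mul_geom, Finset.card_cons]
    induction p with
    | zero =>
      have h0 := sum_nodalWeight_eq_zero (Finset.cons b I hb) X hX
        (by rw [Finset.card_cons]; lia)
      have h1 := ih hXI 0
      simp only [pow_zero, mul_one]
      rw [h0, zcoeff_of_neg _ (by push_cast; lia), zcoeff_of_neg _ (by push_cast; lia)]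
      simp
    | succ p ihp =>
      have h1 : zcoeff ((∏ a ∈ I, geom (X a)) * geom (X b))
          (((p + 1 : ℕ) : ℤ) + 1 - ((I.card + 1 : ℕ) : ℤ) - 1) =
          ∑ a ∈ Finset.cons b I hb, Lagrange.nodalWeight (Finset.cons b I hb) X a * X a ^ p := by
        rw [← ihp, ← zcoeff_mul_geom]
        congr 1; push_cast; ring
      rw [h1, show ((p + 1 : ℕ) : ℤ) + 1 - ((I.card + 1 : ℕ) : ℤ) = (p : ℤ) + 1 - I.card by
        push_cast; ring, ih hXI, Finset.sum_cons, Finset.sum_cons]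
      have h2 : ∀ a ∈ I, Lagrange.nodalWeight I X a =
          Lagrange.nodalWeight (Finset.cons b I hb) X a * (X a - X b) := by
        intro a ha
        have hab : a ≠ b := fun h => hb (h ▸ ha)
        have hne : X a - X b ≠ 0 := sub_ne_zero.mpr fun h =>
          hab (hX (by simp [ha]) (by simp) h)
        rw [Lagrange.nodalWeight, Lagrange.nodalWeight, Finset.cons_eq_insert,
          Finset.erase_insert_of_ne hab.symm, Finset.prod_insert (by simp [hb])]
        field_simp
      rw [Finset.sum_congr rfl fun a ha => by rw [h2 a ha], mul_add, Finset.mul_sum,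
        add_left_comm, ← Finset.sum_add_distrib]
      congr 1
      · ring
      · refine Finset.sum_congr rfl fun a _ => ?_
        ring

theorem nodalWeight_eq_mul_prod_sdiff {I S : Finset ℕ} (X : ℕ → F) (hS : S ⊆ I) {a : ℕ}
    (ha : a ∈ S) : Lagrange.nodalWeight I X a =
      Lagrange.nodalWeight S X a * ∏ b ∈ I \ S, (X a - X b)⁻¹ := by
  have hd : Disjoint (S.erase a) (I \ S) :=
    Finset.disjoint_of_subset_left (Finset.erase_subset _ _) Finset.disjoint_sdiff
  rw [Lagrange.nodalWeight, Lagrange.nodalWeight, ← Finset.prod_union hd]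
  refine Finset.prod_congr ?_ fun _ _ => rfl
  ext b
  simp only [Finset.mem_erase, Finset.mem_union, Finset.mem_sdiff]
  constructor
  · rintro ⟨h1, h2⟩
    by_cases h3 : b ∈ S
    · exact Or.inl ⟨h1, h3⟩
    · exact Or.inr ⟨h2, h3⟩
  · rintro (⟨h1, h2⟩ | ⟨h1, h2⟩)
    · exact ⟨h1, hS h2⟩
    · exact ⟨fun h => h2 (h ▸ ha), h1⟩

/-- The complete homogeneous symmetric function of degree `m` of the variable `y` together with
the alphabet of generating series `Q`. -/
def truncatedEval (Q : PowerSeries F) (m : ℕ) (y : F) : F :=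
  ∑ q ∈ Finset.range (m + 1), PowerSeries.coeff q Q * y ^ (m - q)

theorem zcoeff_prod_geom_mul (I : Finset ℕ) (X : ℕ → F) (hX : Set.InjOn X I) (ℓ m : ℕ)
    (hℓ : ℓ ≤ I.card) (Q : PowerSeries F) (j : ℕ) (hj : j < ℓ) :
    zcoeff ((∏ a ∈ I, geom (X a)) * Q) ((m : ℤ) + 1 - ℓ + j) =
      ∑ a ∈ I, (X a ^ (I.card - ℓ) * truncatedEval Q m (X a)) *
        (Lagrange.nodalWeight I X a * X a ^ j) := by
  have hI : I.Nonempty := Finset.card_pos.mp (by lia)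
  rw [zcoeff_mul _ _ _ (m + 1) fun q hq => Or.inr (by lia)]
  have h1 : ∀ q ∈ Finset.range (m + 1), PowerSeries.coeff q Q *
      zcoeff (∏ a ∈ I, geom (X a)) ((m : ℤ) + 1 - ℓ + j - q) =
      ∑ a ∈ I, PowerSeries.coeff q Q *
        (Lagrange.nodalWeight I X a * X a ^ (m - q + (I.card - ℓ) + j)) := by
    intro q hq
    rw [Finset.mem_range] at hq
    rw [← Finset.mul_sum, ← zcoeff_prod_geom I X hX hI]
    congr 2
    lia
  rw [Finset.sum_congr rfl h1, Finset.sum_comm]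
  refine Finset.sum_congr rfl fun a _ => ?_
  rw [truncatedEval, Finset.mul_sum, Finset.sum_mul]
  refine Finset.sum_congr rfl fun q _ => ?_
  rw [pow_add, pow_add]
  ring

theorem jacobiTrudi_eq_sum (ℓ : ℕ) (I : Finset ℕ) (X : ℕ → F) (hX : Set.InjOn X I)
    (hℓ : ℓ ≤ I.card) (Q : ℕ → PowerSeries F) (lam : ℕ → ℕ) :
    jacobiTrudi ℓ (fun i => (∏ a ∈ I, geom (X a)) * Q i) (fun i => lam i) =
      Matrix.of fun i j : Fin ℓ => ∑ a ∈ I,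
        (X a ^ (I.card - ℓ) * truncatedEval (Q i) (lam i + (ℓ - 1 - i)) (X a)) *
          (Lagrange.nodalWeight I X a * X a ^ (j : ℕ)) := by
  ext i j
  rw [jacobiTrudi, Matrix.of_apply, Matrix.of_apply,
    ← zcoeff_prod_geom_mul I X hX ℓ _ hℓ (Q i) j j.2]
  congr 1
  have := i.2
  lia

theorem det_jacobiTrudi_eq_sum_powersetCard (ℓ : ℕ) (I : Finset ℕ) (X : ℕ → F)
    (hX : Set.InjOn X I) (hℓ : ℓ ≤ I.card) (Q : ℕ → PowerSeries F) (lam : ℕ → ℕ) :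
    (jacobiTrudi ℓ (fun i => (∏ a ∈ I, geom (X a)) * Q i) (fun i => lam i)).det =
      ∑ S ∈ Finset.powersetCard ℓ I, (∏ i ∈ I \ S, ∏ j ∈ S, X j / (X j - X i)) *
        (jacobiTrudi ℓ (fun i => (∏ a ∈ S, geom (X a)) * Q i) (fun i => lam i)).det := by
  rw [jacobiTrudi_eq_sum ℓ I X hX hℓ,
    det_sum_mul ℓ I
      (fun i a => X a ^ (I.card - ℓ) * truncatedEval (Q i) (lam i + (ℓ - 1 - i)) (X a))
      (fun a j => Lagrange.nodalWeight I X a * X a ^ (j : ℕ))]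
  refine Finset.sum_congr rfl fun S hS => ?_
  obtain ⟨hSI, hSc⟩ := Finset.mem_powersetCard.mp hS
  set A : Matrix (Fin ℓ) (Fin ℓ) F := Matrix.of fun i q =>
    truncatedEval (Q i) (lam i + (ℓ - 1 - i)) (X (nthElement S q)) with hA
  set B : Matrix (Fin ℓ) (Fin ℓ) F := Matrix.of fun q j =>
    Lagrange.nodalWeight S X (nthElement S q) * X (nthElement S q) ^ (j : ℕ) with hB
  have hmul : jacobiTrudi ℓ (fun i => (∏ a ∈ S, geom (X a)) * Q i) (fun i => lam i) = A * B := by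
    rw [jacobiTrudi_eq_sum ℓ S X (hX.mono (by exact_mod_cast hSI)) hSc.ge]
    ext i j
    rw [Matrix.mul_apply, Matrix.of_apply, ← sum_nthElement hSc]
    simp [hA, hB, hSc]
  have hdetA : (Matrix.of fun i q : Fin ℓ => X (nthElement S q) ^ (I.card - ℓ) *
      truncatedEval (Q i) (lam i + (ℓ - 1 - i)) (X (nthElement S q))).det =
      (∏ a ∈ S, X a ^ (I.card - ℓ)) * A.det := by
    rw [← prod_nthElement hSc (fun a => X a ^ (I.card - ℓ)), ← Matrix.det_mul_row]
    rfl
  have hdetB : (Matrix.of fun q j : Fin ℓ => Lagrange.nodalWeight I X (nthElement S q) *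
      X (nthElement S q) ^ (j : ℕ)).det =
      (∏ a ∈ S, ∏ b ∈ I \ S, (X a - X b)⁻¹) * B.det := by
    rw [← prod_nthElement hSc (fun a => ∏ b ∈ I \ S, (X a - X b)⁻¹), ← Matrix.det_mul_column]
    congr 1
    ext q j
    simp only [Matrix.of_apply, hB]
    rw [nodalWeight_eq_mul_prod_sdiff X hSI (nthElement_mem hSc q)]
    ring
  have hratio : ∏ i ∈ I \ S, ∏ j ∈ S, X j / (X j - X i) =
      (∏ a ∈ S, X a ^ (I.card - ℓ)) * ∏ a ∈ S, ∏ b ∈ I \ S, (X a - X b)⁻¹ := by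
    rw [Finset.prod_comm, ← Finset.prod_mul_distrib]
    refine Finset.prod_congr rfl fun a _ => ?_
    simp only [div_eq_mul_inv]
    rw [Finset.prod_mul_distrib, Finset.prod_const, Finset.card_sdiff_of_subset hSI, hSc]
  rw [hdetA, hdetB, hmul, Matrix.det_mul, hratio]
  ring

end Field

theorem prod_Icc_one (m : ℕ) (f : ℕ → PowerSeries R) :
    ∏ a ∈ Finset.Icc 1 m, f a = ∏ a ∈ Finset.range m, f (a + 1) := by
  induction m with
  | zero => simp
  | succ m ih => rw [Finset.prod_Icc_succ_top (by lia), ih, Finset.prod_range_succ]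

theorem dualGroth_eq_det_flat (ℓ n k : ℕ) (hk : 1 ≤ k) (hkl : k ≤ ℓ) (lam : ℕ → ℕ)
    (hlam : ∀ a b : ℕ, a ≤ b → b < ℓ → lam b ≤ lam a)
    (hflat : ∀ a : ℕ, a < k → lam a = lam 0) (x t : ℕ → R) :
    dualGroth ℓ n lam (fun _ => 0) x t =
      (jacobiTrudi ℓ (fun i => (∏ a ∈ Finset.range n, geom (x (a + 1))) *
        (∏ b ∈ Finset.range (k - 1), geom (t (b + 1))) *
          ∏ b ∈ Finset.Ico k (i + 1), geom (t b)) (fun i => lam i)).det := by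
  rw [dualGroth_eq_det ℓ n lam hlam]
  unfold flaggedSeries
  rw [det_jacobiTrudi_flat ℓ k hk hkl lam hflat, prod_Icc_one n, prod_Icc_one (k - 1)]

/-- **Fehér–Némethi–Rimányi-type identity for refined dual Grothendieck
polynomials.**  Let `λ` be a partition with exactly `ℓ` positive parts
(`ℓ ≤ n`) with `λ_1 = ⋯ = λ_k`, and set `x_{n+j} := t_j` for `j = 1,…,k-1`
(the alphabet `X`).  Then, in any field in which the `X_1,…,X_{n+k-1}` are
pairwise distinct,
`g_λ(x_1,…,x_n;t_1,…,t_{ℓ-1})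
  = Σ_{S = {j_1<⋯<j_ℓ} ⊆ {1,…,n+k-1}} (∏_{i∈S̄}∏_{j∈S} x_j/(x_j-x_i)) ·
      g_λ(x_{j_1},…,x_{j_{ℓ-k+1}}; x_{j_{ℓ-k+2}},…,x_{j_ℓ},t_k,…,t_{ℓ-1})`. -/
theorem refined_dual_grothendieck_FNR
    {F : Type*} [Field F] (n ℓ k : ℕ) (hk1 : 1 ≤ k) (hkl : k ≤ ℓ) (hln : ℓ ≤ n)
    (lam : ℕ → ℕ)
    (hlam : ∀ a b : ℕ, a ≤ b → b < ℓ → lam b ≤ lam a)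
    (hpos : ∀ r : ℕ, r < ℓ → 0 < lam r)
    (hflat : ∀ a : ℕ, a < k → lam a = lam 0)
    (x t : ℕ → F)
    (hdist : ∀ i j : ℕ, 1 ≤ i → i ≤ n + k - 1 → 1 ≤ j → j ≤ n + k - 1 → i ≠ j →
      extAlphabet n x t i ≠ extAlphabet n x t j) :
    dualGroth ℓ n lam (fun _ => 0) x t =
      ∑ S ∈ Finset.powersetCard ℓ (Finset.Icc 1 (n + k - 1)),
        (∏ i ∈ Finset.Icc 1 (n + k - 1) \ S, ∏ j ∈ S,
          extAlphabet n x t j / (extAlphabet n x t j - extAlphabet n x t i)) *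
          dualGroth ℓ (ℓ - k + 1) lam (fun _ => 0)
            (fun a => extAlphabet n x t ((S.sort (· ≤ ·)).getD (a - 1) 0))
            (fun a => if a ≤ k - 1 then
                extAlphabet n x t ((S.sort (· ≤ ·)).getD (ℓ - k + a) 0)
              else t a) := by
  have hX : Set.InjOn (extAlphabet n x t) (Finset.Icc 1 (n + k - 1)) := by
    intro i hi j hj h
    rw [Finset.coe_Icc, Set.mem_Icc] at hi hj
    by_contra hij
    exact hdist i j hi.1 hi.2 hj.1 hj.2 hij h
  have hleft : (∏ a ∈ Finset.range n, geom (x (a + 1))) *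
      (∏ b ∈ Finset.range (k - 1), geom (t (b + 1))) =
      ∏ a ∈ Finset.Icc 1 (n + k - 1), geom (extAlphabet n x t a) := by
    rw [prod_Icc_one, show n + k - 1 = n + (k - 1) by lia, Finset.prod_range_add]
    congr 1
    · refine Finset.prod_congr rfl fun a ha => ?_
      rw [Finset.mem_range] at ha
      rw [extAlphabet, if_pos (by lia)]
    · refine Finset.prod_congr rfl fun b _ => ?_
      rw [extAlphabet, if_neg (by lia), show n + b + 1 - n = b + 1 by lia]
  rw [dualGroth_eq_det_flat ℓ n k hk1 hkl lam hlam hflat, hleft,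
    det_jacobiTrudi_eq_sum_powersetCard ℓ _ _ hX (by rw [Nat.card_Icc]; lia)]
  refine Finset.sum_congr rfl fun S hS => ?_
  have hSc := (Finset.mem_powersetCard.mp hS).2
  congr 1
  rw [dualGroth_eq_det_flat ℓ _ k hk1 hkl lam hlam hflat]
  congr 2
  ext1 i
  congr 1
  · rw [← prod_nthElement hSc fun a => geom (extAlphabet n x t a),
      Fin.prod_univ_eq_prod_range (fun q => geom (extAlphabet n x t (nthElement S q))) ℓ]
    conv_lhs => rw [show ℓ = ℓ - k + 1 + (k - 1) by lia]
    rw [Finset.prod_range_add]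
    congr 1
    refine Finset.prod_congr rfl fun b hb => ?_
    rw [Finset.mem_range] at hb
    rw [if_pos (by lia), nthElement, show ℓ - k + 1 + b = ℓ - k + (b + 1) by lia]
  · refine Finset.prod_congr rfl fun b hb => ?_
    rw [Finset.mem_Ico] at hb
    rw [if_neg (by lia)]

end
end

section
/- Let μ ⊆ λ be partitions, each with at most ℓ parts (μ_i ≤ λ_i for all i), and let n ≥ 1. Then the skew refined dual Grothendieck polynomial has the expansion g_{λ/μ}(x_1,…,x_n; t_1,…,t_{ℓ−1}) = Σ over chains of partitions μ = λ^{(0)} ⊆ λ^{(1)} ⊆ … ⊆ λ^{(n)} = λ (each with at most ℓ parts, containment componentwise) of ∏_{i=1}^{n} ∏_{j=1}^{ℓ} t_j^{max(λ^{(i−1)}_j, λ^{(i)}_{j+1}) − λ^{(i−1)}_j} · x_i^{λ^{(i)}_j − max(λ^{(i−1)}_j, λ^{(i)}_{j+1})}, where λ^{(i)}_{ℓ+1} := 0. (All exponents appearing are nonnegative, and the exponent of t_ℓ is always 0, so only t_1,…,t_{ℓ−1} occur.) -/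
open scoped Classical

noncomputable section

variable {R : Type*} [CommRing R]

/-- The value of a tuple `q : Fin ℓ → Fin B` at a (possibly out of range)
index `j : ℕ`, defaulting to `0`; used for `λ^{(i)}_{j+1}` with
`λ^{(i)}_{ℓ+1} := 0`. -/
def valAt {ℓ B : ℕ} (q : Fin ℓ → Fin B) (j : ℕ) : ℕ :=
  if h : j < ℓ then (q ⟨j, h⟩ : ℕ) else 0

/-- A monotone function on `Fin m` takes values `≤ i` exactly on an initial segment. -/
lemma lt_card_filter_le_iff {m : ℕ} {g : Fin m → ℕ} (hg : Monotone g) (k : Fin m) (i : ℕ) :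
    (k : ℕ) < (Finset.univ.filter fun c => g c ≤ i).card ↔ g k ≤ i := by
  constructor
  · intro h
    by_contra! hk
    have hsub : (Finset.univ.filter fun c => g c ≤ i) ⊆ Finset.Iio k := fun c hc => by
      rw [Finset.mem_filter] at hc
      rw [Finset.mem_Iio]
      by_contra! hkc
      have := hg hkc
      omega
    have := Finset.card_le_card hsub
    rw [Fin.card_Iio] at this
    omega
  · intro h
    have hsub : Finset.Iic k ⊆ Finset.univ.filter fun c => g c ≤ i := fun c hc => by
      rw [Finset.mem_filter]
      exact ⟨Finset.mem_univ _, (hg (Finset.mem_Iic.1 hc)).trans h⟩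
    have := Finset.card_le_card hsub
    rw [Fin.card_Iic] at this
    omega

lemma prod_prod_Ico_castSucc_succ {M : Type*} [CommMonoid M] (f : ℕ → M) (n : ℕ)
    {a : Fin (n + 1) → ℕ} (ha : Monotone a) :
    ∏ i : Fin n, ∏ k ∈ Finset.Ico (a i.castSucc) (a i.succ), f k =
      ∏ k ∈ Finset.Ico (a 0) (a (Fin.last n)), f k := by
  induction n with
  | zero => simp
  | succ n ih =>
    rw [Fin.prod_univ_castSucc]
    have h := ih (a := fun i => a i.castSucc) fun i i' h => ha (Fin.castSucc_le_castSucc_iff.2 h)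
    simp only [← Fin.castSucc_succ] at h ⊢
    rw [h, Fin.castSucc_zero, Fin.succ_last]
    exact Finset.prod_Ico_consecutive f (ha (Fin.zero_le _)) (ha (Fin.le_last _))

lemma prod_Ico_ite_lt {M : Type*} [CommMonoid M] {p q b : ℕ} (hpq : p ≤ q) (hbq : b ≤ q)
    (u v : M) :
    ∏ k ∈ Finset.Ico p q, (if k < b then u else v) = u ^ (max p b - p) * v ^ (q - max p b) := by
  rw [← Finset.prod_Ico_consecutive _ (le_max_left p b) (max_le hpq hbq),
    Finset.prod_congr rfl (g := fun _ => u), Finset.prod_congr (s₁ := Finset.Ico (max p b) q) rfl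
      (g := fun _ => v)]
  · simp
  · intro k hk
    rw [Finset.mem_Ico] at hk
    exact if_neg (by omega)
  · intro k hk
    rw [Finset.mem_Ico] at hk
    exact if_pos (by omega)

/-- Chains of partitions `mu = λ⁽⁰⁾ ⊆ ⋯ ⊆ λ⁽ⁿ⁾ = lam` with at most `ℓ` parts. -/
def IsPartitionChain (ℓ n : ℕ) (lam mu : ℕ → ℕ)
    (c : Fin (n + 1) → Fin ℓ → Fin (lam 0 + 1)) : Prop :=
  (∀ i : Fin (n + 1), ∀ j j' : Fin ℓ, (j : ℕ) ≤ (j' : ℕ) → (c i j' : ℕ) ≤ (c i j : ℕ)) ∧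
  (∀ i : Fin n, ∀ j : Fin ℓ, (c i.castSucc j : ℕ) ≤ (c i.succ j : ℕ)) ∧
  (∀ j : Fin ℓ, (c 0 j : ℕ) = mu j.1) ∧
  (∀ j : Fin ℓ, (c (Fin.last n) j : ℕ) = lam j.1)

/-- The `i`-th partition of the chain `c` is the set of boxes of `T` with entry at most `i`. -/
def IsLevelChain {ℓ n : ℕ} {lam : ℕ → ℕ} (T : YBox ℓ lam → Fin (n + 1))
    (c : Fin (n + 1) → Fin ℓ → Fin (lam 0 + 1)) : Prop :=
  (∀ i j (k : Fin (lam j.1)), T ⟨j, k⟩ ≤ i ↔ (k : ℕ) < c i j) ∧ ∀ i j, (c i j : ℕ) ≤ lam j.1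

/-- The chain of level sets of a filling. -/
def levelChain {ℓ n : ℕ} {lam : ℕ → ℕ} (h0 : ∀ j : Fin ℓ, lam j.1 ≤ lam 0)
    (T : YBox ℓ lam → Fin (n + 1)) : Fin (n + 1) → Fin ℓ → Fin (lam 0 + 1) := fun i j =>
  ⟨(Finset.univ.filter fun k : Fin (lam j.1) => (T ⟨j, k⟩ : ℕ) ≤ i).card,
    Nat.lt_succ_of_le (((Finset.card_le_univ _).trans (Fintype.card_fin _).le).trans (h0 j))⟩

/-- The filling whose level sets are the members of a chain. -/
def chainFilling {ℓ n : ℕ} {lam : ℕ → ℕ} (c : Fin (n + 1) → Fin ℓ → Fin (lam 0 + 1)) :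
    YBox ℓ lam → Fin (n + 1) := fun b =>
  ⟨(Finset.univ.filter fun i : Fin n => (c i.castSucc b.1 : ℕ) ≤ b.2).card,
    Nat.lt_succ_of_le ((Finset.card_le_univ _).trans (Fintype.card_fin _).le)⟩

section

variable {ℓ n : ℕ} {lam mu : ℕ → ℕ}

lemma IsSkewRPP.row_le {T : YBox ℓ lam → Fin (n + 1)} (hT : IsSkewRPP ℓ n lam mu T) (j : Fin ℓ)
    {k k' : Fin (lam j.1)} (h : k ≤ k') : T ⟨j, k⟩ ≤ T ⟨j, k'⟩ := by
  by_cases hk : mu j.1 ≤ k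
  · exact hT.2.1 j k k' hk h
  · have := (hT.1 ⟨j, k⟩).2 (not_le.1 hk)
    rw [Fin.le_def, this]
    exact Nat.zero_le _

lemma IsSkewRPP.col_le {T : YBox ℓ lam → Fin (n + 1)} (hT : IsSkewRPP ℓ n lam mu T)
    (hmu : ∀ a b : ℕ, a ≤ b → b < ℓ → mu b ≤ mu a) {j j' : Fin ℓ} (hj : (j : ℕ) ≤ j')
    {k : ℕ} (hk : k < lam j.1) (hk' : k < lam j'.1) : T ⟨j, ⟨k, hk⟩⟩ ≤ T ⟨j', ⟨k, hk'⟩⟩ := by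
  by_cases h : mu j.1 ≤ k
  · exact hT.2.2 j j' _ _ hj rfl h ((hmu _ _ hj j'.2).trans h)
  · have := (hT.1 ⟨j, ⟨k, hk⟩⟩).2 (not_le.1 h)
    rw [Fin.le_def, this]
    exact Nat.zero_le _

lemma IsPartitionChain.monotone {c : Fin (n + 1) → Fin ℓ → Fin (lam 0 + 1)}
    (hc : IsPartitionChain ℓ n lam mu c) (j : Fin ℓ) : Monotone fun i => (c i j : ℕ) :=
  Fin.monotone_iff_le_succ.2 fun i => hc.2.1 i j

lemma IsSkewRPP.isLevelChain {T : YBox ℓ lam → Fin (n + 1)} (hT : IsSkewRPP ℓ n lam mu T)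
    (h0 : ∀ j : Fin ℓ, lam j.1 ≤ lam 0) : IsLevelChain T (levelChain h0 T) := by
  refine ⟨fun i j k => ?_, fun i j =>
    (Finset.card_le_univ (Finset.univ.filter fun k => (T ⟨j, k⟩ : ℕ) ≤ i)).trans
      (Fintype.card_fin _).le⟩
  exact (lt_card_filter_le_iff (g := fun k => (T ⟨j, k⟩ : ℕ))
    (fun k k' h => hT.row_le j h) k i).symm

lemma IsPartitionChain.isLevelChain {c : Fin (n + 1) → Fin ℓ → Fin (lam 0 + 1)}
    (hc : IsPartitionChain ℓ n lam mu c) : IsLevelChain (chainFilling c) c := by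
  have hm := hc.monotone
  refine ⟨fun i j k => ?_, fun i j => (hm j (Fin.le_last i)).trans (hc.2.2.2 j).le⟩
  induction i using Fin.lastCases with
  | last => simp [Fin.le_last, hc.2.2.2 j]
  | cast i =>
    have := lt_card_filter_le_iff (g := fun i : Fin n => (c i.castSucc j : ℕ))
      (fun i i' h => hm j (Fin.castSucc_le_castSucc_iff.2 h)) i k
    rw [Fin.le_def]
    exact not_lt.symm.trans ((not_congr this).trans not_le)

namespace IsLevelChain

variable {T : YBox ℓ lam → Fin (n + 1)} {c : Fin (n + 1) → Fin ℓ → Fin (lam 0 + 1)}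

lemma isPartitionChain (h : IsLevelChain T c) (hT : IsSkewRPP ℓ n lam mu T)
    (hlam : ∀ a b : ℕ, a ≤ b → b < ℓ → lam b ≤ lam a)
    (hmu : ∀ a b : ℕ, a ≤ b → b < ℓ → mu b ≤ mu a)
    (hsub : ∀ r : ℕ, r < ℓ → mu r ≤ lam r) : IsPartitionChain ℓ n lam mu c := by
  refine ⟨fun i j j' hj => ?_, fun i j => ?_, fun j => ?_, fun j => ?_⟩
  · by_contra! hlt
    have hk' := hlt.trans_le (h.2 i j')
    have hk := hk'.trans_le (hlam _ _ hj j'.2)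
    exact lt_irrefl _
      ((h.1 i j ⟨_, hk⟩).1 ((hT.col_le hmu hj hk hk').trans ((h.1 i j' ⟨_, hk'⟩).2 hlt)))
  · by_contra! hlt
    have hk := hlt.trans_le (h.2 _ j)
    exact lt_irrefl _
      ((h.1 _ j ⟨_, hk⟩).1 (((h.1 _ j ⟨_, hk⟩).2 hlt).trans (Fin.castSucc_lt_succ).le))
  · have key : ∀ k : Fin (lam j.1), (k : ℕ) < mu j.1 ↔ (k : ℕ) < c 0 j := fun k => by
      rw [← h.1 0 j k, ← hT.1 ⟨j, k⟩, Fin.le_zero_iff, Fin.ext_iff, Fin.val_zero]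
    rcases lt_trichotomy (c 0 j : ℕ) (mu j.1) with hlt | heq | hlt
    · exact absurd ((key ⟨_, hlt.trans_le (hsub _ j.2)⟩).1 hlt) (lt_irrefl _)
    · exact heq
    · exact absurd ((key ⟨_, hlt.trans_le (h.2 0 j)⟩).2 hlt) (lt_irrefl _)
  · refine le_antisymm (h.2 _ j) ?_
    by_contra! hlt
    exact lt_irrefl _ ((h.1 _ j ⟨_, hlt⟩).1 (Fin.le_last _))

lemma isSkewRPP (h : IsLevelChain T c) (hc : IsPartitionChain ℓ n lam mu c) :
    IsSkewRPP ℓ n lam mu T := by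
  refine ⟨fun ⟨j, k⟩ => ?_, fun j k k' _ hk => ?_, fun j j' k k' hj hk _ _ => ?_⟩
  · rw [← hc.2.2.1 j, ← h.1 0 j k, Fin.le_zero_iff, Fin.ext_iff, Fin.val_zero]
  · rw [h.1]
    exact hk.trans_lt ((h.1 _ j k').1 le_rfl)
  · rw [h.1, hk]
    exact ((h.1 _ j' k').1 le_rfl).trans_le (hc.1 _ j j' hj)

lemma chain_unique (h : IsLevelChain T c) {c' : Fin (n + 1) → Fin ℓ → Fin (lam 0 + 1)}
    (h' : IsLevelChain T c') : c = c' := by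
  funext i j
  refine Fin.ext (le_antisymm ?_ ?_) <;> by_contra! hlt
  · have hk := hlt.trans_le (h.2 i j)
    exact lt_irrefl _ ((h'.1 i j ⟨_, hk⟩).1 ((h.1 i j ⟨_, hk⟩).2 hlt))
  · have hk := hlt.trans_le (h'.2 i j)
    exact lt_irrefl _ ((h.1 i j ⟨_, hk⟩).1 ((h'.1 i j ⟨_, hk⟩).2 hlt))

lemma filling_unique (h : IsLevelChain T c) {T' : YBox ℓ lam → Fin (n + 1)}
    (h' : IsLevelChain T' c) : T = T' := by
  funext ⟨j, k⟩
  refine le_antisymm ?_ ?_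
  · exact (h.1 _ j k).2 ((h'.1 _ j k).1 le_rfl)
  · exact (h'.1 _ j k).2 ((h.1 _ j k).1 le_rfl)

lemma filling_eq_succ (h : IsLevelChain T c) {i : Fin n} {j : Fin ℓ} {k : Fin (lam j.1)}
    (hk : (c i.castSucc j : ℕ) ≤ k) (hk' : (k : ℕ) < c i.succ j) : T ⟨j, k⟩ = i.succ := by
  refine le_antisymm ((h.1 _ j k).2 hk') ?_
  rw [← Fin.castSucc_lt_iff_succ_le, ← not_le, h.1]
  exact not_lt.2 hk

lemma boxWeight_eq (h : IsLevelChain T c) (hc : IsPartitionChain ℓ n lam mu c) (x t : ℕ → R)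
    {i : Fin n} {j : Fin ℓ} {k : Fin (lam j.1)}
    (hk : (c i.castSucc j : ℕ) ≤ k) (hk' : (k : ℕ) < c i.succ j) :
    boxWeight ℓ n lam mu x t T ⟨j, k⟩ =
      if (k : ℕ) < valAt (c i.succ) (j.1 + 1) then t (j.1 + 1) else x (i.1 + 1) := by
  have hmuk : mu j.1 ≤ k := by
    rw [← hc.2.2.1 j]
    exact (hc.monotone j (Fin.zero_le _)).trans hk
  have hT := h.filling_eq_succ hk hk'
  rw [boxWeight, if_pos hmuk, hT, Fin.val_succ]
  refine if_congr ⟨?_, fun hv => ?_⟩ rfl rfl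
  · rintro ⟨hr, hcol, he⟩
    rw [valAt, dif_pos hr]
    exact (h.1 _ ⟨j.1 + 1, hr⟩ ⟨k, hcol⟩).1 he.le
  · by_cases hr : j.1 + 1 < ℓ
    · rw [valAt, dif_pos hr] at hv
      exact ⟨hr, hv.trans_le (h.2 _ _), h.filling_eq_succ
        ((hc.1 _ j ⟨j.1 + 1, hr⟩ (Nat.le_succ _)).trans hk) hv⟩
    · rw [valAt, dif_neg hr] at hv
      exact absurd hv (Nat.not_lt_zero _)

lemma prod_row_boxWeight (h : IsLevelChain T c) (hc : IsPartitionChain ℓ n lam mu c)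
    (x t : ℕ → R) (j : Fin ℓ) :
    ∏ k : Fin (lam j.1), boxWeight ℓ n lam mu x t T ⟨j, k⟩ =
      ∏ i : Fin n,
        t (j.1 + 1) ^
            (max ((c i.castSucc j : ℕ)) (valAt (c i.succ) (j.1 + 1)) - (c i.castSucc j : ℕ)) *
          x (i.1 + 1) ^
            ((c i.succ j : ℕ) - max ((c i.castSucc j : ℕ)) (valAt (c i.succ) (j.1 + 1))) := by
  set f : ℕ → R := fun k =>
    if hk : k < lam j.1 then boxWeight ℓ n lam mu x t T ⟨j, ⟨k, hk⟩⟩ else 1 with hf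
  have hrow : ∏ k : Fin (lam j.1), boxWeight ℓ n lam mu x t T ⟨j, k⟩ =
      ∏ k ∈ Finset.Ico (mu j.1) (lam j.1), f k := by
    have hmulam : mu j.1 ≤ lam j.1 := hc.2.2.1 j ▸ h.2 0 j
    have hone : ∏ k ∈ Finset.Ico 0 (mu j.1), f k = 1 := Finset.prod_eq_one fun k hk => by
      have hk := (Finset.mem_Ico.1 hk).2
      rw [hf]
      dsimp only
      rw [dif_pos (hk.trans_le hmulam), boxWeight, if_neg (not_le.2 hk)]
    have hfin : ∏ k : Fin (lam j.1), boxWeight ℓ n lam mu x t T ⟨j, k⟩ =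
        ∏ k : Fin (lam j.1), f k := Finset.prod_congr rfl fun k _ => by simp [hf]
    rw [hfin, Fin.prod_univ_eq_prod_range, Finset.range_eq_Ico,
      ← Finset.prod_Ico_consecutive f (Nat.zero_le _) hmulam, hone, one_mul]
  rw [hrow, ← hc.2.2.1 j, ← hc.2.2.2 j, ← prod_prod_Ico_castSucc_succ f n (hc.monotone j)]
  refine Finset.prod_congr rfl fun i _ => ?_
  have hval : valAt (c i.succ) (j.1 + 1) ≤ c i.succ j := by
    unfold valAt
    split_ifs with hr
    · exact hc.1 _ j ⟨j.1 + 1, hr⟩ (Nat.le_succ _)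
    · exact Nat.zero_le _
  rw [← prod_Ico_ite_lt (hc.2.1 i j) hval]
  refine Finset.prod_congr rfl fun k hk => ?_
  rw [Finset.mem_Ico] at hk
  rw [hf]
  dsimp only
  rw [dif_pos (hk.2.trans_le (h.2 _ j))]
  exact h.boxWeight_eq hc x t (k := ⟨k, _⟩) hk.1 hk.2

end IsLevelChain

end

/-- **Chain expansion of skew refined dual Grothendieck polynomials** (the
transition-probability factorization of the LPP process):
`g_{λ/μ}(x_1,…,x_n; t_1,…,t_{ℓ-1})
  = Σ_{μ = λ⁽⁰⁾ ⊆ λ⁽¹⁾ ⊆ ⋯ ⊆ λ⁽ⁿ⁾ = λ}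
      ∏_{i=1}^{n} ∏_{j=1}^{ℓ}
        t_j^{max(λ⁽ⁱ⁻¹⁾_j, λ⁽ⁱ⁾_{j+1}) - λ⁽ⁱ⁻¹⁾_j}
        x_i^{λ⁽ⁱ⁾_j - max(λ⁽ⁱ⁻¹⁾_j, λ⁽ⁱ⁾_{j+1})}`,
the chains consisting of partitions with at most `ℓ` parts, with
`λ⁽ⁱ⁾_{ℓ+1} := 0`. -/
theorem skew_refined_dual_grothendieck_chain_expansion
    {R : Type*} [CommRing R] (ℓ n : ℕ) (hl : 1 ≤ ℓ) (hn : 1 ≤ n)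
    (lam mu : ℕ → ℕ)
    (hlam : ∀ a b : ℕ, a ≤ b → b < ℓ → lam b ≤ lam a)
    (hmu : ∀ a b : ℕ, a ≤ b → b < ℓ → mu b ≤ mu a)
    (hsub : ∀ r : ℕ, r < ℓ → mu r ≤ lam r)
    (x t : ℕ → R) :
    dualGroth ℓ n lam mu x t =
      ∑ c ∈ Finset.univ.filter
          (fun c : Fin (n + 1) → Fin ℓ → Fin (lam 0 + 1) =>
            (∀ i : Fin (n + 1), ∀ j j' : Fin ℓ, (j : ℕ) ≤ (j' : ℕ) →
              (c i j' : ℕ) ≤ (c i j : ℕ)) ∧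
            (∀ i : Fin n, ∀ j : Fin ℓ, (c i.castSucc j : ℕ) ≤ (c i.succ j : ℕ)) ∧
            (∀ j : Fin ℓ, (c 0 j : ℕ) = mu j.1) ∧
            (∀ j : Fin ℓ, (c (Fin.last n) j : ℕ) = lam j.1)),
        ∏ i : Fin n, ∏ j : Fin ℓ,
          t (j.1 + 1) ^
              (max ((c i.castSucc j : ℕ)) (valAt (c i.succ) (j.1 + 1)) -
                (c i.castSucc j : ℕ)) *
            x (i.1 + 1) ^
              ((c i.succ j : ℕ) -
                max ((c i.castSucc j : ℕ)) (valAt (c i.succ) (j.1 + 1))) := by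
  have h0 : ∀ j : Fin ℓ, lam j.1 ≤ lam 0 := fun j => hlam 0 j.1 (Nat.zero_le _) j.2
  unfold dualGroth
  refine Finset.sum_bij' (fun T _ => levelChain h0 T) (fun c _ => chainFilling c)
    (fun T hT => ?_) (fun c hc => ?_) (fun T hT => ?_) (fun c hc => ?_) (fun T hT => ?_)
  · have hT := (Finset.mem_filter.1 hT).2
    exact Finset.mem_filter.2
      ⟨Finset.mem_univ _, (hT.isLevelChain h0).isPartitionChain hT hlam hmu hsub⟩
  · have hc : IsPartitionChain ℓ n lam mu c := (Finset.mem_filter.1 hc).2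
    exact Finset.mem_filter.2 ⟨Finset.mem_univ _, hc.isLevelChain.isSkewRPP hc⟩
  · have hT := (Finset.mem_filter.1 hT).2
    have h := hT.isLevelChain h0
    exact (h.isPartitionChain hT hlam hmu hsub).isLevelChain.filling_unique h
  · have hc : IsPartitionChain ℓ n lam mu c := (Finset.mem_filter.1 hc).2
    have h := hc.isLevelChain
    exact ((h.isSkewRPP hc).isLevelChain h0).chain_unique h
  · have hT := (Finset.mem_filter.1 hT).2
    have h := hT.isLevelChain h0
    rw [Finset.prod_comm, Fintype.prod_sigma]
    exact Finset.prod_congr rfl fun j _ =>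
      h.prod_row_boxWeight (h.isPartitionChain hT hlam hmu hsub) x t j
end
end
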